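/- arXiv:1809.04875 — 9 statements merged into one kernel-verified Lean document; each statement's English description precedes it below -/
import Mathlib

section
/- Let N ≥ 3 and let B be the open unit ball in ℝ^N. Suppose k : ℝ^N → ℝ is nonnegative, radial, and α-Hölder continuous on the closed unit ball for some α ∈ (0,1], with k(0) = 0, and suppose there exists a point x₀ in the closed unit ball with k(x₀) > 0. Then there exists λ* > 0 such that for every λ > λ* there exists a radial function u, continuous on the closed unit ball and twice continuously differentiable on B, with u > 0 in B, u = 0 on the unit sphere, satisfying −Δu(x) = (1 + λ·k(x))·u(x)^((N+2)/(N−2)) for all x ∈ B. -/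
open scoped NNReal
open MeasureTheory Filter Set Metric

noncomputable def laplacian {N : ℕ} (u : EuclideanSpace ℝ (Fin N) → ℝ)
    (x : EuclideanSpace ℝ (Fin N)) : ℝ :=
  ∑ i, fderiv ℝ (fun y => fderiv ℝ u y (EuclideanSpace.single i (1:ℝ))) x
      (EuclideanSpace.single i (1:ℝ))


noncomputable def PF (N : ℕ) (f : ℝ → ℝ) (s : ℝ) : ℝ := ∫ t in (0:ℝ)..s, t ^ (N - 1) * f t
noncomputable def Pq (N : ℕ) (f : ℝ → ℝ) (s : ℝ) : ℝ := ∫ t in (0:ℝ)..1, t ^ (N - 1) * f (s * t)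
noncomputable def PG (N : ℕ) (f : ℝ → ℝ) (r : ℝ) : ℝ := ∫ s in r..(1:ℝ), s * Pq N f s
noncomputable def PB (N : ℕ) (f g : ℝ → ℝ) : ℝ := ∫ s in (0:ℝ)..1, s ^ (N - 1) * (f s * PG N g s)

lemma Pq_cont (N : ℕ) {f : ℝ → ℝ} (hf : Continuous f) : Continuous (Pq N f) := by
  unfold Pq
  apply intervalIntegral.continuous_parametric_intervalIntegral_of_continuous'
  fun_prop

lemma Pq_PF {N : ℕ} (hN : 3 ≤ N) (f : ℝ → ℝ) (s : ℝ) : s ^ N * Pq N f s = PF N f s := by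
  unfold Pq PF
  have h := intervalIntegral.smul_integral_comp_mul_left (a := 0) (b := 1)
    (fun t => t ^ (N - 1) * f t) s
  simp only [mul_zero, mul_one, smul_eq_mul] at h
  rw [← h]
  have : s ^ N = s * s ^ (N - 1) := by
    rw [← pow_succ']; congr 1; omega
  rw [this, mul_assoc, ← intervalIntegral.integral_const_mul]
  congr 1
  apply intervalIntegral.integral_congr
  intro t _
  simp only [mul_pow]; ring

lemma PF_deriv (N : ℕ) {f : ℝ → ℝ} (hf : Continuous f) (s : ℝ) :
    HasDerivAt (PF N f) (s ^ (N - 1) * f s) s := by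
  have hc : Continuous (fun t : ℝ => t ^ (N - 1) * f t) := by fun_prop
  exact intervalIntegral.integral_hasDerivAt_right (hc.intervalIntegrable _ _)
    hc.stronglyMeasurable.stronglyMeasurableAtFilter hc.continuousAt

lemma PG_deriv (N : ℕ) {f : ℝ → ℝ} (hf : Continuous f) (s : ℝ) :
    HasDerivAt (PG N f) (-(s * Pq N f s)) s := by
  have hc : Continuous (fun t : ℝ => t * Pq N f t) := by
    have := Pq_cont N hf
    fun_prop
  exact intervalIntegral.integral_hasDerivAt_left (hc.intervalIntegrable _ _)
    hc.stronglyMeasurable.stronglyMeasurableAtFilter hc.continuousAt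

lemma PG_cont (N : ℕ) {f : ℝ → ℝ} (hf : Continuous f) : Continuous (PG N f) :=
  continuous_iff_continuousAt.2 fun s => (PG_deriv N hf s).continuousAt

lemma PG_one (N : ℕ) (f : ℝ → ℝ) : PG N f 1 = 0 := by simp [PG]

lemma PB_eq {N : ℕ} (hN : 3 ≤ N) {f g : ℝ → ℝ} (hf : Continuous f) (hg : Continuous g) :
    PB N f g = ∫ s in (0:ℝ)..1, s ^ (N + 1) * (Pq N f s * Pq N g s) := by
  have hqf := Pq_cont N hf
  have hqg := Pq_cont N hg
  have hGg := PG_cont N hg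
  have hd : ∀ s ∈ uIcc (0:ℝ) 1, HasDerivAt (fun s => PF N f s * PG N g s)
      (s ^ (N - 1) * (f s * PG N g s) - s ^ (N + 1) * (Pq N f s * Pq N g s)) s := by
    intro s _
    have := (PF_deriv N hf s).mul (PG_deriv N hg s)
    refine this.congr_deriv ?_
    rw [← Pq_PF hN]
    ring
  have hi := intervalIntegral.integral_eq_sub_of_hasDerivAt hd
    (Continuous.intervalIntegrable (by fun_prop) _ _)
  rw [intervalIntegral.integral_sub (Continuous.intervalIntegrable (by fun_prop) _ _)
    (Continuous.intervalIntegrable (by fun_prop) _ _), PG_one] at hi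
  have h0 : PF N f 0 = 0 := by simp [PF]
  rw [h0] at hi
  unfold PB
  linarith

lemma Pq_smul (N : ℕ) (f : ℝ → ℝ) (c s : ℝ) : Pq N (fun x => c * f x) s = c * Pq N f s := by
  unfold Pq
  rw [← intervalIntegral.integral_const_mul]
  congr 1; ext t; ring

lemma PG_smul (N : ℕ) (f : ℝ → ℝ) (c s : ℝ) : PG N (fun x => c * f x) s = c * PG N f s := by
  unfold PG
  rw [← intervalIntegral.integral_const_mul]
  congr 1; ext t; rw [Pq_smul]; ring

lemma Pq_sub (N : ℕ) {f g : ℝ → ℝ} (hf : Continuous f) (hg : Continuous g) (s : ℝ) :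
    Pq N (fun x => f x - g x) s = Pq N f s - Pq N g s := by
  unfold Pq
  rw [← intervalIntegral.integral_sub (Continuous.intervalIntegrable (by fun_prop) _ _)
    (Continuous.intervalIntegrable (by fun_prop) _ _)]
  congr 1; ext t; ring

lemma PG_sub (N : ℕ) {f g : ℝ → ℝ} (hf : Continuous f) (hg : Continuous g) (s : ℝ) :
    PG N (fun x => f x - g x) s = PG N f s - PG N g s := by
  have hqf := Pq_cont N hf
  have hqg := Pq_cont N hg
  unfold PG
  rw [← intervalIntegral.integral_sub (Continuous.intervalIntegrable (by fun_prop) _ _)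
    (Continuous.intervalIntegrable (by fun_prop) _ _)]
  congr 1; ext t; rw [Pq_sub N hf hg]; ring

lemma PB_symm {N : ℕ} (hN : 3 ≤ N) {f g : ℝ → ℝ} (hf : Continuous f) (hg : Continuous g) :
    PB N f g = PB N g f := by
  rw [PB_eq hN hf hg, PB_eq hN hg hf]
  congr 1; ext t; ring

lemma PB_smul_right (N : ℕ) (f g : ℝ → ℝ) (c : ℝ) : PB N f (fun x => c * g x) = c * PB N f g := by
  unfold PB
  rw [← intervalIntegral.integral_const_mul]
  congr 1; ext t; rw [PG_smul]; ring

lemma PB_smul_left (N : ℕ) (f g : ℝ → ℝ) (c : ℝ) : PB N (fun x => c * f x) g = c * PB N f g := by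
  unfold PB
  rw [← intervalIntegral.integral_const_mul]
  congr 1; ext t; ring

lemma PB_sub {N : ℕ} (hN : 3 ≤ N) {f g : ℝ → ℝ} (hf : Continuous f) (hg : Continuous g) :
    PB N (fun x => f x - g x) (fun x => f x - g x) = PB N f f - 2 * PB N f g + PB N g g := by
  have hqf := Pq_cont N hf
  have hqg := Pq_cont N hg
  have hfg : Continuous (fun x => f x - g x) := by fun_prop
  rw [PB_eq hN hfg hfg, PB_eq hN hf hf, PB_eq hN hf hg, PB_eq hN hg hg,
    ← intervalIntegral.integral_const_mul,
    ← intervalIntegral.integral_sub (Continuous.intervalIntegrable (by fun_prop) _ _)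
    (Continuous.intervalIntegrable (by fun_prop) _ _),
    ← intervalIntegral.integral_add (Continuous.intervalIntegrable (by fun_prop) _ _)
    (Continuous.intervalIntegrable (by fun_prop) _ _)]
  congr 1; ext t; rw [Pq_sub N hf hg]; ring

lemma PB_nonneg {N : ℕ} (hN : 3 ≤ N) {f : ℝ → ℝ} (hf : Continuous f) : 0 ≤ PB N f f := by
  rw [PB_eq hN hf hf]
  apply intervalIntegral.integral_nonneg (by norm_num)
  intro s hs
  have := hs.1
  have := mul_self_nonneg (Pq N f s)
  positivity

/-- Cauchy–Schwarz in the normalised form. -/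
lemma PB_cs {N : ℕ} (hN : 3 ≤ N) {f h : ℝ → ℝ} (hf : Continuous f) (hh : Continuous h)
    (h1 : PB N f f = 1) : (PB N h f) ^ 2 ≤ PB N h h := by
  have hc : Continuous (fun x => PB N h f * f x) := by fun_prop
  have := PB_nonneg hN (hh.sub hc)
  have h2 := PB_sub hN hh hc
  rw [PB_smul_right, PB_smul_right, PB_smul_left, h1] at h2
  have h3 : 0 ≤ PB N (fun x => h x - PB N h f * f x) (fun x => h x - PB N h f * f x) := this
  rw [h2] at h3
  nlinarith

lemma PG_pointwise {N : ℕ} (hN : 3 ≤ N) {f : ℝ → ℝ} (hf : Continuous f) {r : ℝ} (hr : 0 < r)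
    (hr1 : r ≤ 1) : (PG N f r) ^ 2 * r ^ (N - 2) ≤ PB N f f := by
  have hqf := Pq_cont N hf
  have key : ∀ c : ℝ, 0 ≤ PB N f f - 2 * c * PG N f r + c ^ 2 * (r ^ (N - 2))⁻¹ := by
    intro c
    have hpos : ∀ s ∈ Icc r 1, s ≠ 0 := fun s hs => (lt_of_lt_of_le hr hs.1).ne'
    have hB : ∫ s in r..(1:ℝ), s ^ (N + 1) * (Pq N f s * Pq N f s) ≤ PB N f f := by
      rw [PB_eq hN hf hf]
      apply intervalIntegral.integral_mono_interval hr.le hr1 le_rfl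
      · refine (ae_restrict_iff' measurableSet_Ioc).2 (ae_of_all _ ?_)
        intro s hs
        have := hs.1
        have := mul_self_nonneg (Pq N f s)
        show (0:ℝ) ≤ _
        positivity
      · exact Continuous.intervalIntegrable (by fun_prop) _ _
    have hcinv : ContinuousOn (fun s : ℝ => (s ^ (N - 1))⁻¹) (uIcc r 1) := by
      rw [uIcc_of_le hr1]
      exact ContinuousOn.inv₀ (by fun_prop) fun s hs => pow_ne_zero _ (hpos s hs)
    have hI : ∫ s in r..(1:ℝ), (s ^ (N - 1))⁻¹ ≤ (r ^ (N - 2))⁻¹ := by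
      have h2 : ∫ s in r..(1:ℝ), (r ^ (N - 3))⁻¹ * (s ^ 2)⁻¹ = (r ^ (N - 3))⁻¹ * (r⁻¹ - 1) := by
        rw [intervalIntegral.integral_const_mul]
        congr 1
        have : ∀ s ∈ uIcc r 1, HasDerivAt (fun s : ℝ => - s⁻¹) ((s ^ 2)⁻¹) s := by
          intro s hs
          rw [uIcc_of_le hr1] at hs
          exact (hasDerivAt_inv (hpos s hs)).neg.congr_deriv (by simp)
        rw [intervalIntegral.integral_eq_sub_of_hasDerivAt this]
        · simp; ring
        · apply ContinuousOn.intervalIntegrable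
          rw [uIcc_of_le hr1]
          exact ContinuousOn.inv₀ (by fun_prop) fun s hs => pow_ne_zero _ (hpos s hs)
      calc ∫ s in r..(1:ℝ), (s ^ (N - 1))⁻¹ ≤ ∫ s in r..(1:ℝ), (r ^ (N - 3))⁻¹ * (s ^ 2)⁻¹ := by
            apply intervalIntegral.integral_mono_on hr1
            · exact hcinv.intervalIntegrable
            · apply ContinuousOn.intervalIntegrable
              rw [uIcc_of_le hr1]
              exact continuousOn_const.mul (ContinuousOn.inv₀ (by fun_prop) fun s hs => pow_ne_zero _ (hpos s hs))
            · intro s hs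
              have hs0 : 0 < s := lt_of_lt_of_le hr hs.1
              rw [← mul_inv]
              apply inv_anti₀ (by positivity)
              have : s ^ (N - 1) = s ^ (N - 3) * s ^ 2 := by rw [← pow_add]; congr 1; omega
              rw [this]
              have := hs.1
              gcongr
        _ = _ := h2
        _ ≤ (r ^ (N - 3))⁻¹ * r⁻¹ := by
            apply mul_le_mul_of_nonneg_left (by linarith) (by positivity)
        _ = _ := by
            rw [← mul_inv, ← pow_succ]; congr 2; omega
    have hsq : 0 ≤ ∫ s in r..(1:ℝ), (s ^ (N + 1) * (Pq N f s * Pq N f s) - 2 * c * (s * Pq N f s)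
        + c ^ 2 * (s ^ (N - 1))⁻¹) := by
      apply intervalIntegral.integral_nonneg hr1
      intro s hs
      have hs0 : 0 < s := lt_of_lt_of_le hr hs.1
      have e1 : s ^ (N + 1) = s ^ (N - 1) * s ^ 2 := by rw [← pow_add]; congr 1; omega
      have : s ^ (N + 1) * (Pq N f s * Pq N f s) - 2 * c * (s * Pq N f s)
        + c ^ 2 * (s ^ (N - 1))⁻¹ = s ^ (N - 1) * (s * Pq N f s - c * (s ^ (N - 1))⁻¹) ^ 2 := by
        rw [e1]
        have : s ^ (N - 1) ≠ 0 := by positivity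
        field_simp
        ring
      rw [this]
      positivity
    rw [intervalIntegral.integral_add, intervalIntegral.integral_sub,
      intervalIntegral.integral_const_mul, intervalIntegral.integral_const_mul] at hsq
    · have : c ^ 2 * ∫ s in r..(1:ℝ), (s ^ (N - 1))⁻¹ ≤ c ^ 2 * (r ^ (N - 2))⁻¹ :=
        mul_le_mul_of_nonneg_left hI (sq_nonneg c)
      unfold PG
      linarith
    · exact Continuous.intervalIntegrable (by fun_prop) _ _
    · exact Continuous.intervalIntegrable (by fun_prop) _ _
    · exact Continuous.intervalIntegrable (by fun_prop) _ _
    · exact (continuousOn_const.mul hcinv).intervalIntegrable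
  have := key (PG N f r * r ^ (N - 2))
  have hp : r ^ (N - 2) ≠ 0 := by positivity
  have e : (PG N f r * r ^ (N - 2)) ^ 2 * (r ^ (N - 2))⁻¹ = PG N f r ^ 2 * r ^ (N - 2) := by
    field_simp
  rw [e] at this
  nlinarith

lemma Pq_nonneg (N : ℕ) {f : ℝ → ℝ} (h0 : ∀ x ∈ Icc (0:ℝ) 1, 0 ≤ f x) {s : ℝ}
    (hs : s ∈ Icc (0:ℝ) 1) : 0 ≤ Pq N f s := by
  unfold Pq
  apply intervalIntegral.integral_nonneg (by norm_num)
  intro t ht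
  have := h0 (s * t) ⟨mul_nonneg hs.1 ht.1, mul_le_one₀ hs.2 ht.1 ht.2⟩
  have := ht.1
  positivity

lemma PG_nonneg (N : ℕ) {f : ℝ → ℝ} (h0 : ∀ x ∈ Icc (0:ℝ) 1, 0 ≤ f x) {r : ℝ}
    (hr : r ∈ Icc (0:ℝ) 1) : 0 ≤ PG N f r := by
  unfold PG
  apply intervalIntegral.integral_nonneg hr.2
  intro s hs
  have h1 : s ∈ Icc (0:ℝ) 1 := ⟨hr.1.trans hs.1, hs.2⟩
  exact mul_nonneg h1.1 (Pq_nonneg N h0 h1)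

lemma Pq_le_inv {N : ℕ} (hN : 3 ≤ N) {f : ℝ → ℝ} (hf : Continuous f) {C : ℝ} (hC : 0 ≤ C)
    (h : ∀ x ∈ Ioc (0:ℝ) 1, f x ≤ C * x⁻¹) {s : ℝ} (hs : s ∈ Icc (0:ℝ) 1) :
    s * Pq N f s ≤ C := by
  rcases eq_or_lt_of_le hs.1 with h0 | hs0
  · rw [← h0]; simpa using hC
  unfold Pq
  rw [← intervalIntegral.integral_const_mul]
  calc _ ≤ ∫ t in (0:ℝ)..1, C := by
        apply intervalIntegral.integral_mono_on (by norm_num)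
          (Continuous.intervalIntegrable (by fun_prop) _ _)
          (Continuous.intervalIntegrable (by fun_prop) _ _)
        intro t ht
        rcases eq_or_lt_of_le ht.1 with ht' | ht0
        · rw [← ht', zero_pow (by omega)]; simpa using hC
        have h1 := h (s * t) ⟨by positivity, mul_le_one₀ hs.2 ht.1 ht.2⟩
        calc s * (t ^ (N - 1) * f (s * t)) ≤ s * (t ^ (N - 1) * (C * (s * t)⁻¹)) := by gcongr
          _ = t ^ (N - 2) * C := by
              have : t ^ (N - 1) = t ^ (N - 2) * t := by rw [← pow_succ]; congr 1; omega
              rw [this]; field_simp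
          _ ≤ 1 * C := by
              gcongr
              exact pow_le_one₀ ht.1 ht.2
          _ = C := one_mul C
    _ = C := by simp

lemma PG_barrier {N : ℕ} (hN : 3 ≤ N) {f : ℝ → ℝ} (hf : Continuous f) {a L : ℝ} (ha : 0 ≤ a)
    (hL : 0 ≤ L) (h : ∀ x ∈ Ioc (0:ℝ) 1, f x ≤ a * x ^ (-(11/5) : ℝ) + L) {r : ℝ}
    (hr : r ∈ Ioc (0:ℝ) 1) : PG N f r ≤ (25/4 * a + L) * r ^ (-(1/5) : ℝ) := by
  have hqf := Pq_cont N hf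
  have h1 : ∀ s ∈ Ioc (0:ℝ) 1, Pq N f s ≤ 5/4 * a * s ^ (-(11/5) : ℝ) + L := by
    intro s hs
    have hs0 := hs.1
    have hint : IntervalIntegrable (fun t : ℝ => t ^ (-(1/5) : ℝ)) volume 0 1 :=
      intervalIntegral.intervalIntegrable_rpow' (by norm_num)
    calc Pq N f s ≤ ∫ t in (0:ℝ)..1, ((a * s ^ (-(11/5) : ℝ)) * t ^ (-(1/5) : ℝ) + L) := by
          unfold Pq
          apply intervalIntegral.integral_mono_on (by norm_num)
            (Continuous.intervalIntegrable (by fun_prop) _ _)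
            ((hint.const_mul _).add (by simp))
          intro t ht
          rcases eq_or_lt_of_le ht.1 with ht' | ht0
          · rw [← ht', zero_pow (by omega), Real.zero_rpow (by norm_num)]; simpa using hL
          have h1 := h (s * t) ⟨by positivity, mul_le_one₀ hs.2 ht.1 ht.2⟩
          calc t ^ (N - 1) * f (s * t) ≤ t ^ (N - 1) * (a * (s * t) ^ (-(11/5) : ℝ) + L) := by
                gcongr
            _ ≤ t ^ 2 * (a * (s * t) ^ (-(11/5) : ℝ) + L) := by
                apply mul_le_mul_of_nonneg_right _ (by positivity)
                exact pow_le_pow_of_le_one ht.1 ht.2 (by omega)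
            _ = (a * s ^ (-(11/5) : ℝ)) * t ^ (-(1/5) : ℝ) + t ^ 2 * L := by
                rw [Real.mul_rpow hs0.le ht.1]
                have : t ^ (-(1/5) : ℝ) = t ^ 2 * t ^ (-(11/5) : ℝ) := by
                  rw [← Real.rpow_natCast, ← Real.rpow_add ht0]; norm_num
                rw [this]; ring
            _ ≤ (a * s ^ (-(11/5) : ℝ)) * t ^ (-(1/5) : ℝ) + 1 * L := by
                gcongr
                exact pow_le_one₀ ht.1 ht.2
            _ = _ := by ring
      _ = _ := by
          rw [intervalIntegral.integral_add (hint.const_mul _) (by simp),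
            intervalIntegral.integral_const_mul, integral_rpow (by left; norm_num)]
          norm_num
          ring
  have hr0 := hr.1
  have hint : IntervalIntegrable (fun t : ℝ => t ^ (-(6/5) : ℝ)) volume r 1 := by
    apply intervalIntegral.intervalIntegrable_rpow
    right; rw [uIcc_of_le hr.2]; intro hh; linarith [hh.1]
  calc PG N f r ≤ ∫ s in r..(1:ℝ), (5/4 * a * s ^ (-(6/5) : ℝ) + L) := by
        unfold PG
        apply intervalIntegral.integral_mono_on hr.2
            (Continuous.intervalIntegrable (by fun_prop) _ _)
            ((hint.const_mul _).add (by simp))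
        intro s hs
        have hs0 : 0 < s := lt_of_lt_of_le hr0 hs.1
        calc s * Pq N f s ≤ s * (5/4 * a * s ^ (-(11/5) : ℝ) + L) := by
              have := h1 s ⟨hs0, hs.2⟩
              gcongr
          _ = 5/4 * a * s ^ (-(6/5) : ℝ) + s * L := by
              have : s ^ (-(6/5) : ℝ) = s * s ^ (-(11/5) : ℝ) := by
                nth_rewrite 2 [← Real.rpow_one s]
                rw [← Real.rpow_add hs0]; norm_num
              rw [this]; ring
          _ ≤ 5/4 * a * s ^ (-(6/5) : ℝ) + 1 * L := by
              have := hs.2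
              gcongr
          _ = _ := by ring
    _ = 5/4 * a * (5 * (r ^ (-(1/5) : ℝ) - 1)) + (1 - r) * L := by
        rw [intervalIntegral.integral_add (hint.const_mul _) (by simp),
            intervalIntegral.integral_const_mul, integral_rpow]
        · have e : (-(6/5) : ℝ) + 1 = -(1/5) := by norm_num
          rw [e, Real.one_rpow, intervalIntegral.integral_const, smul_eq_mul]
          ring
        · right
          refine ⟨by norm_num, ?_⟩
          rw [uIcc_of_le hr.2]; intro hh; linarith [hh.1]
    _ ≤ _ := by
        have h2 : 1 ≤ r ^ (-(1/5) : ℝ) :=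
          Real.one_le_rpow_of_pos_of_le_one_of_nonpos hr0 hr.2 (by norm_num)
        nlinarith [mul_nonneg ha (sub_nonneg.2 h2), mul_nonneg hL (sub_nonneg.2 h2), mul_nonneg hL hr0.le]

noncomputable def Pp (N : ℕ) : ℝ := ((N : ℝ) + 2) / ((N : ℝ) - 2)

lemma Pp_gt {N : ℕ} (hN : 3 ≤ N) : 1 < Pp N := by
  have : (3:ℝ) ≤ N := by exact_mod_cast hN
  unfold Pp
  rw [lt_div_iff₀ (by linarith)]
  linarith

lemma Pp_le {N : ℕ} (hN : 3 ≤ N) : Pp N ≤ 5 := by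
  have : (3:ℝ) ≤ N := by exact_mod_cast hN
  unfold Pp
  rw [div_le_iff₀ (by linarith)]
  linarith

/-- pointwise bound for the power -/
lemma pow_bound {N : ℕ} (hN : 3 ≤ N) {v r : ℝ} (hv : 0 ≤ v) (hr : 0 < r)
    (h : v ^ 2 * r ^ (N - 2) ≤ 1) : v ^ Pp N ≤ (r ^ 2)⁻¹ * v := by
  have hN' : (3:ℝ) ≤ N := by exact_mod_cast hN
  have hN2 : (0:ℝ) < (N:ℝ) - 2 := by linarith
  have hp := Pp_gt hN
  have e : v ^ Pp N = v ^ (Pp N - 1) * v := by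
    rcases eq_or_lt_of_le hv with h0 | h0
    · rw [← h0, Real.zero_rpow (by linarith)]; simp
    · nth_rewrite 3 [← Real.rpow_one v]
      rw [← Real.rpow_add h0]; congr 1; ring
  rw [e]
  apply mul_le_mul_of_nonneg_right _ hv
  have h1 : v ^ 2 ≤ (r ^ (N - 2))⁻¹ := by
    rw [← one_div, le_div_iff₀ (by positivity)]; exact h
  have h2 : (v ^ 2) ^ (2 / ((N:ℝ) - 2)) ≤ ((r ^ (N - 2))⁻¹) ^ (2 / ((N:ℝ) - 2)) :=
    Real.rpow_le_rpow (by positivity) h1 (by positivity)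
  have e1 : (v ^ 2) ^ (2 / ((N:ℝ) - 2)) = v ^ (Pp N - 1) := by
    rw [← Real.rpow_natCast, ← Real.rpow_mul hv]
    congr 1
    unfold Pp
    field_simp
    push_cast
    ring
  have e2 : ((r ^ (N - 2))⁻¹) ^ (2 / ((N:ℝ) - 2)) = (r ^ 2)⁻¹ := by
    rw [← Real.rpow_natCast, ← Real.rpow_neg hr.le, ← Real.rpow_mul hr.le, ← Real.rpow_natCast,
      ← Real.rpow_neg hr.le]
    congr 1
    rw [Nat.cast_sub (by omega)]
    push_cast
    field_simp
  rw [e1, e2] at h2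
  exact h2

lemma convex_ineq {p : ℝ} (hp : 1 < p) {a b : ℝ} (ha : 0 ≤ a) (hb : 0 ≤ b) :
    (p + 1) * (a ^ p * b - a ^ p * a) ≤ b ^ p * b - a ^ p * a := by
  rcases eq_or_lt_of_le ha with h0 | h0
  · rw [← h0, Real.zero_rpow (by linarith)]; simp; positivity
  have h := one_add_mul_self_le_rpow_one_add (s := b / a - 1) (p := p + 1)
    (by have : 0 ≤ b / a := by positivity
        linarith) (by linarith)
  have e : 1 + (b / a - 1) = b / a := by ring
  rw [e, Real.div_rpow hb ha, Real.rpow_add_one h0.ne', Real.rpow_add_one' hb (by linarith),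
    le_div_iff₀ (by positivity)] at h
  have : (1 + (p + 1) * (b / a - 1)) * (a ^ p * a) = a ^ p * a + (p + 1) * (a ^ p * b - a ^ p * a) := by
    field_simp
  rw [this] at h
  linarith

noncomputable def Ph (N : ℕ) (K f : ℝ → ℝ) : ℝ → ℝ := fun x => K x * PG N f x ^ Pp N
noncomputable def Pt (N : ℕ) (K f : ℝ → ℝ) : ℝ := Real.sqrt (PB N (Ph N K f) (Ph N K f))
noncomputable def PS (N : ℕ) (K f : ℝ → ℝ) : ℝ → ℝ := fun x => (Pt N K f)⁻¹ * Ph N K f x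

lemma Ph_cont {N : ℕ} (hN : 3 ≤ N) {K f : ℝ → ℝ} (hK : Continuous K) (hf : Continuous f) :
    Continuous (Ph N K f) := by
  unfold Ph
  exact hK.mul ((PG_cont N hf).rpow_const fun x => Or.inr (by linarith [Pp_gt hN]))

structure Good (N : ℕ) (K : ℝ → ℝ) (τ M : ℝ) (f : ℝ → ℝ) : Prop where
  cont : Continuous f
  nonneg : ∀ x ∈ Icc (0:ℝ) 1, 0 ≤ f x
  norm : PB N f f = 1
  low : τ ≤ PB N (Ph N K f) f
  up : ∀ x ∈ Ioc (0:ℝ) 1, PG N f x ≤ M * x ^ (-(1/5) : ℝ)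

lemma Phi_mono {N : ℕ} (hN : 3 ≤ N) {K f g : ℝ → ℝ} (hK : Continuous K)
    (hK0 : ∀ x ∈ Icc (0:ℝ) 1, 0 ≤ K x) (hf : Continuous f) (hg : Continuous g)
    (hf0 : ∀ x ∈ Icc (0:ℝ) 1, 0 ≤ f x) (hg0 : ∀ x ∈ Icc (0:ℝ) 1, 0 ≤ g x) :
    (Pp N + 1) * (PB N (Ph N K f) g - PB N (Ph N K f) f) ≤
      PB N (Ph N K g) g - PB N (Ph N K f) f := by
  have h1 := Ph_cont hN hK hf
  have h2 := Ph_cont hN hK hg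
  have h3 := PG_cont N hf
  have h4 := PG_cont N hg
  unfold PB
  rw [← intervalIntegral.integral_sub (Continuous.intervalIntegrable (by fun_prop) _ _)
    (Continuous.intervalIntegrable (by fun_prop) _ _),
    ← intervalIntegral.integral_sub (Continuous.intervalIntegrable (by fun_prop) _ _)
    (Continuous.intervalIntegrable (by fun_prop) _ _), ← intervalIntegral.integral_const_mul]
  apply intervalIntegral.integral_mono_on (by norm_num)
    (Continuous.intervalIntegrable (by fun_prop) _ _)
    (Continuous.intervalIntegrable (by fun_prop) _ _)
  intro s hs
  have hc := convex_ineq (Pp_gt hN) (PG_nonneg N hf0 hs) (PG_nonneg N hg0 hs)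
  have hs0 := hs.1
  have hk := hK0 s hs
  have := mul_le_mul_of_nonneg_left hc (show 0 ≤ s ^ (N - 1) * K s by positivity)
  unfold Ph
  linarith

lemma Ph_nonneg (N : ℕ) {K f : ℝ → ℝ} 
    (hK0 : ∀ x ∈ Icc (0:ℝ) 1, 0 ≤ K x) 
    (hf0 : ∀ x ∈ Icc (0:ℝ) 1, 0 ≤ f x) : ∀ x ∈ Icc (0:ℝ) 1, 0 ≤ Ph N K f x := by
  intro x hx
  exact mul_nonneg (hK0 x hx) (Real.rpow_nonneg (PG_nonneg N hf0 hx) _)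

lemma good_step {N : ℕ} (hN : 3 ≤ N) {K : ℝ → ℝ} (hK : Continuous K)
    (hK0 : ∀ x ∈ Icc (0:ℝ) 1, 0 ≤ K x) {τ M A η ρ : ℝ} (hτ : 0 < τ) (hM : 0 ≤ M) (hA : 0 ≤ A)
    (hη : 0 ≤ η) (hρ : 0 < ρ) (hKA : ∀ x ∈ Icc (0:ℝ) 1, K x ≤ A)
    (hKη : ∀ x ∈ Ioc (0:ℝ) ρ, K x ≤ η)
    (hbal : 25/4 * (η * M) + A * (ρ ^ N)⁻¹ ≤ τ * M) {f : ℝ → ℝ} (hf : Good N K τ M f) :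
    Good N K τ M (PS N K f) ∧ PB N (Ph N K f) f ≤ Pt N K f ∧
    (Pp N + 1) * (Pt N K f - PB N (Ph N K f) f) ≤
      PB N (Ph N K (PS N K f)) (PS N K f) - PB N (Ph N K f) f ∧
    PB N (PS N K f) f = (Pt N K f)⁻¹ * PB N (Ph N K f) f := by
  have hc := Ph_cont hN hK hf.cont
  have hn := Ph_nonneg N hK0 hf.nonneg
  have hlow := hf.low
  have hcs : PB N (Ph N K f) f ≤ Pt N K f := by
    apply Real.le_sqrt_of_sq_le
    exact PB_cs hN hf.cont hc hf.norm
  have ht : 0 < Pt N K f := by linarith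
  have htsq : Pt N K f * Pt N K f = PB N (Ph N K f) (Ph N K f) :=
    Real.mul_self_sqrt (PB_nonneg hN hc)
  have hSc : Continuous (PS N K f) := by unfold PS; fun_prop
  have hSn : ∀ x ∈ Icc (0:ℝ) 1, 0 ≤ PS N K f x := fun x hx =>
    mul_nonneg (by positivity) (hn x hx)
  have hSf : PB N (PS N K f) f = (Pt N K f)⁻¹ * PB N (Ph N K f) f := by
    unfold PS; rw [PB_smul_left]
  have hhS : PB N (Ph N K f) (PS N K f) = Pt N K f := by
    unfold PS; rw [PB_smul_right, ← htsq]; field_simp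
  have hnorm : PB N (PS N K f) (PS N K f) = 1 := by
    have e : PB N (PS N K f) (PS N K f) = (Pt N K f)⁻¹ * PB N (Ph N K f) (PS N K f) :=
      PB_smul_left N _ _ _
    rw [e, hhS]; field_simp
  have hmono := Phi_mono hN hK hK0 hf.cont hSc hf.nonneg hSn
  rw [hhS] at hmono
  refine ⟨⟨hSc, hSn, hnorm, ?_, ?_⟩, hcs, hmono, hSf⟩
  · have := Pp_gt hN
    nlinarith
  · intro x hx
    have hb : PG N (Ph N K f) x ≤ (25/4 * (η * M) + A * (ρ ^ N)⁻¹) * x ^ (-(1/5) : ℝ) := by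
      apply PG_barrier hN hc (by positivity) (by positivity) _ hx
      intro y hy
      have hy0 := hy.1
      have hyI : y ∈ Icc (0:ℝ) 1 := ⟨hy.1.le, hy.2⟩
      have hpw := PG_pointwise hN hf.cont hy.1 hy.2
      rw [hf.norm] at hpw
      have hv0 := PG_nonneg N hf.nonneg hyI
      have hv := pow_bound hN hv0 hy.1 hpw
      have hKy := hK0 y hyI
      have hstep : Ph N K f y ≤ K y * ((y ^ 2)⁻¹ * PG N f y) := by
        unfold Ph; gcongr
      by_cases hyρ : y ≤ ρ
      · have e : y ^ (-(11/5) : ℝ) = (y ^ 2)⁻¹ * y ^ (-(1/5) : ℝ) := by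
          rw [← Real.rpow_natCast, ← Real.rpow_neg hy0.le, ← Real.rpow_add hy0]; norm_num
        have h1 : Ph N K f y ≤ η * ((y ^ 2)⁻¹ * (M * y ^ (-(1/5) : ℝ))) := by
          refine hstep.trans ?_
          have := hKη y ⟨hy0, hyρ⟩
          have := hf.up y hy
          gcongr
        rw [e]
        have : 0 ≤ A * (ρ ^ N)⁻¹ := by positivity
        linarith
      · push Not at hyρ
        have hvle : PG N f y ≤ (y ^ (N - 2))⁻¹ := by
          have h1 : 1 ≤ (y ^ (N - 2))⁻¹ := (one_le_inv₀ (by positivity)).2 (pow_le_one₀ hy0.le hy.2)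
          have h2 : PG N f y ^ 2 ≤ (y ^ (N - 2))⁻¹ := by
            rw [← one_div, le_div_iff₀ (by positivity)]; exact hpw
          nlinarith
        have h1 : Ph N K f y ≤ A * (ρ ^ N)⁻¹ := by
          refine hstep.trans ?_
          have := hKA y hyI
          calc K y * ((y ^ 2)⁻¹ * PG N f y) ≤ A * ((y ^ 2)⁻¹ * (y ^ (N - 2))⁻¹) := by gcongr
            _ = A * (y ^ N)⁻¹ := by
                rw [← mul_inv, ← pow_add]; congr 3; omega
            _ ≤ _ := by gcongr
        have : 0 ≤ η * M * y ^ (-(11/5) : ℝ) := by positivity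
        linarith
    unfold PS
    rw [PG_smul]
    have hx' : 0 ≤ x ^ (-(1/5) : ℝ) := Real.rpow_nonneg hx.1.le _
    calc (Pt N K f)⁻¹ * PG N (Ph N K f) x ≤ (Pt N K f)⁻¹ * (τ * M * x ^ (-(1/5) : ℝ)) := by
          gcongr
          exact hb.trans (mul_le_mul_of_nonneg_right hbal hx')
      _ ≤ (Pt N K f)⁻¹ * (Pt N K f * M * x ^ (-(1/5) : ℝ)) := by
          gcongr
          linarith
      _ = _ := by field_simp

/-- Lipschitz control of the next iterate. -/
lemma good_lip {N : ℕ} (hN : 3 ≤ N) {K : ℝ → ℝ} (hK : Continuous K)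
    (hK0 : ∀ x ∈ Icc (0:ℝ) 1, 0 ≤ K x) {τ M A : ℝ} (hτ : 0 < τ) (hM : 0 ≤ M) (hA : 0 ≤ A)
    (hKA : ∀ x ∈ Icc (0:ℝ) 1, K x ≤ A) {f : ℝ → ℝ} (hf : Good N K τ M f)
    (hcs : PB N (Ph N K f) f ≤ Pt N K f) :
    ∀ x ∈ Icc (0:ℝ) 1, ∀ y ∈ Icc (0:ℝ) 1,
      |PG N (PS N K f) x - PG N (PS N K f) y| ≤ τ⁻¹ * (A * M ^ Pp N) * |x - y| := by
  have hc := Ph_cont hN hK hf.cont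
  have hn := Ph_nonneg N hK0 hf.nonneg
  have hlow := hf.low
  have ht : 0 < Pt N K f := by linarith
  have hSc : Continuous (PS N K f) := by unfold PS; fun_prop
  have hq : ∀ s ∈ Icc (0:ℝ) 1, |s * Pq N (PS N K f) s| ≤ τ⁻¹ * (A * M ^ Pp N) := by
    intro s hs
    have h1 : s * Pq N (Ph N K f) s ≤ A * M ^ Pp N := by
      apply Pq_le_inv hN hc (by positivity) _ hs
      intro x hx
      have hx0 := hx.1
      have hxI : x ∈ Icc (0:ℝ) 1 := ⟨hx.1.le, hx.2⟩
      have hG := PG_nonneg N hf.nonneg hxI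
      have hp := Pp_gt hN
      have hp5 := Pp_le hN
      calc Ph N K f x ≤ A * (M * x ^ (-(1/5) : ℝ)) ^ Pp N := by
            unfold Ph
            have := hKA x hxI
            have := hf.up x hx
            have := Real.rpow_le_rpow hG this (show 0 ≤ Pp N by linarith)
            gcongr
        _ = A * M ^ Pp N * x ^ (-(1/5) * Pp N : ℝ) := by
            rw [Real.mul_rpow hM (by positivity), ← Real.rpow_mul hx0.le]; ring
        _ ≤ A * M ^ Pp N * x ^ (-1 : ℝ) := by
            gcongr 1
            apply Real.rpow_le_rpow_of_exponent_ge hx0 hx.2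
            linarith
        _ = _ := by rw [Real.rpow_neg_one]
    have h0 : 0 ≤ s * Pq N (Ph N K f) s := mul_nonneg hs.1 (Pq_nonneg N hn hs)
    have e : s * Pq N (PS N K f) s = (Pt N K f)⁻¹ * (s * Pq N (Ph N K f) s) := by
      unfold PS; rw [Pq_smul]; ring
    rw [e, abs_of_nonneg (by positivity)]
    have : τ ≤ Pt N K f := by linarith
    gcongr
  intro x hx y hy
  have := (convex_Icc (0:ℝ) 1).norm_image_sub_le_of_norm_hasDerivWithin_le
    (f := PG N (PS N K f)) (f' := fun s => -(s * Pq N (PS N K f) s))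
    (C := τ⁻¹ * (A * M ^ Pp N)) (fun s _ => (PG_deriv N hSc s).hasDerivWithinAt)
    (fun s hs => by rw [norm_neg]; exact hq s hs) hy hx
  simpa using this

lemma extract (v : ℕ → ℝ → ℝ) {C L : ℝ} (hC : ∀ n, ∀ x ∈ Icc (0:ℝ) 1, |v n x| ≤ C)
    (hL : ∀ n, ∀ x ∈ Icc (0:ℝ) 1, ∀ y ∈ Icc (0:ℝ) 1, |v n x - v n y| ≤ L * |x - y|) :
    ∃ φ : ℕ → ℕ, StrictMono φ ∧ ∃ w : ℝ → ℝ, Continuous w ∧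
      ∀ x ∈ Icc (0:ℝ) 1, Tendsto (fun n => v (φ n) x) atTop (nhds (w x)) := by
  have hL0 : 0 ≤ L := by
    have := hL 0 0 (by simp) 1 (by simp)
    have h2 := (abs_nonneg _).trans this
    simpa using h2
  have hlip : ∀ n, LipschitzWith (Real.toNNReal L) (fun x : Icc (0:ℝ) 1 => v n x) := by
    intro n
    apply LipschitzWith.of_dist_le_mul
    intro x y
    rw [Real.coe_toNNReal _ hL0]
    exact hL n x x.2 y y.2
  let F : ℕ → BoundedContinuousFunction (Icc (0:ℝ) 1) ℝ := fun n =>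
    BoundedContinuousFunction.mkOfCompact ⟨fun x : Icc (0:ℝ) 1 => v n x, (hlip n).continuous⟩
  have hcomp : IsCompact (closure (range F)) := by
    apply BoundedContinuousFunction.arzela_ascoli (Icc (-C) C) isCompact_Icc
    · rintro f x ⟨n, rfl⟩
      exact abs_le.1 (hC n x x.2)
    · refine (LipschitzWith.uniformEquicontinuous _ (Real.toNNReal L) ?_).equicontinuous
      rintro ⟨f, n, rfl⟩
      exact hlip n
  obtain ⟨g, -, φ, hφ, hg⟩ := hcomp.tendsto_subseq (x := F) fun n => subset_closure ⟨n, rfl⟩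
  refine ⟨φ, hφ, IccExtend (zero_le_one) g, g.continuous.Icc_extend', ?_⟩
  intro x hx
  rw [IccExtend_of_mem _ _ hx]
  have := (BoundedContinuousFunction.tendsto_iff_tendstoUniformly.1 hg).tendsto_at ⟨x, hx⟩
  exact this

lemma Pq_tendsto (N : ℕ) {h : ℕ → ℝ → ℝ} {g : ℝ → ℝ} (hc : ∀ n, Continuous (h n)) {C : ℝ}
    (hC : ∀ n, ∀ x ∈ Icc (0:ℝ) 1, |h n x| ≤ C)
    (hl : ∀ x ∈ Icc (0:ℝ) 1, Tendsto (fun n => h n x) atTop (nhds (g x))) {s : ℝ}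
    (hs : s ∈ Icc (0:ℝ) 1) :
    Tendsto (fun n => Pq N (h n) s) atTop (nhds (Pq N g s)) := by
  unfold Pq
  have hm : ∀ t ∈ uIoc (0:ℝ) 1, s * t ∈ Icc (0:ℝ) 1 ∧ t ∈ Icc (0:ℝ) 1 := by
    intro t ht
    rw [uIoc_of_le zero_le_one] at ht
    exact ⟨⟨mul_nonneg hs.1 ht.1.le, mul_le_one₀ hs.2 ht.1.le ht.2⟩, ht.1.le, ht.2⟩
  apply intervalIntegral.tendsto_integral_filter_of_dominated_convergence (fun _ => C)
  · refine Eventually.of_forall fun n => ?_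
    have := hc n
    exact Continuous.aestronglyMeasurable (by fun_prop)
  · refine Eventually.of_forall fun n => ae_of_all _ fun t ht => ?_
    obtain ⟨h1, h2⟩ := hm t ht
    rw [Real.norm_eq_abs, abs_mul, abs_pow, abs_of_nonneg h2.1]
    have := hC n _ h1
    calc t ^ (N - 1) * |h n (s * t)| ≤ 1 * |h n (s * t)| := by
          gcongr
          exact pow_le_one₀ h2.1 h2.2
      _ ≤ C := by linarith
  · simp
  · refine ae_of_all _ fun t ht => ?_
    exact (hl _ (hm t ht).1).const_mul _

lemma Pq_bound (N : ℕ) {h : ℝ → ℝ} {C : ℝ}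
    (hC : ∀ x ∈ Icc (0:ℝ) 1, |h x| ≤ C) {s : ℝ} (hs : s ∈ Icc (0:ℝ) 1) : |Pq N h s| ≤ C := by
  unfold Pq
  have := intervalIntegral.norm_integral_le_of_norm_le_const (a := 0) (b := 1) (C := C)
    (f := fun t => t ^ (N - 1) * h (s * t)) (by
      intro t ht
      rw [uIoc_of_le zero_le_one] at ht
      rw [Real.norm_eq_abs, abs_mul, abs_pow, abs_of_nonneg ht.1.le]
      have := hC (s * t) ⟨mul_nonneg hs.1 ht.1.le, mul_le_one₀ hs.2 ht.1.le ht.2⟩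
      calc t ^ (N - 1) * |h (s * t)| ≤ 1 * |h (s * t)| := by
            gcongr
            exact pow_le_one₀ ht.1.le ht.2
        _ ≤ C := by linarith)
  simpa using this

lemma PG_tendsto (N : ℕ) {h : ℕ → ℝ → ℝ} {g : ℝ → ℝ} (hc : ∀ n, Continuous (h n)) {C : ℝ}
    (hC : ∀ n, ∀ x ∈ Icc (0:ℝ) 1, |h n x| ≤ C)
    (hl : ∀ x ∈ Icc (0:ℝ) 1, Tendsto (fun n => h n x) atTop (nhds (g x))) {r : ℝ}
    (hr : r ∈ Icc (0:ℝ) 1) :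
    Tendsto (fun n => PG N (h n) r) atTop (nhds (PG N g r)) := by
  unfold PG
  have hm : ∀ t ∈ uIoc r 1, t ∈ Icc (0:ℝ) 1 := by
    intro t ht
    rw [uIoc_of_le hr.2] at ht
    exact ⟨hr.1.trans ht.1.le, ht.2⟩
  apply intervalIntegral.tendsto_integral_filter_of_dominated_convergence (fun _ => C)
  · refine Eventually.of_forall fun n => ?_
    have := Pq_cont N (hc n)
    exact Continuous.aestronglyMeasurable (by fun_prop)
  · refine Eventually.of_forall fun n => ae_of_all _ fun t ht => ?_
    have h2 := hm t ht
    rw [Real.norm_eq_abs, abs_mul, abs_of_nonneg h2.1]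
    have := Pq_bound N (hC n) h2
    calc t * |Pq N (h n) t| ≤ 1 * |Pq N (h n) t| := by
          gcongr
          exact h2.2
      _ ≤ C := by linarith
  · simp
  · refine ae_of_all _ fun t ht => ?_
    exact (Pq_tendsto N hc hC hl (hm t ht)).const_mul _

lemma exists_fixed {N : ℕ} (hN : 3 ≤ N) {K : ℝ → ℝ} (hK : Continuous K)
    (hK0 : ∀ x ∈ Icc (0:ℝ) 1, 0 < K x) {τ M A η ρ : ℝ} (hτ : 0 < τ) (hM : 0 ≤ M) (hA : 0 ≤ A)
    (hη : 0 ≤ η) (hρ : 0 < ρ) (hKA : ∀ x ∈ Icc (0:ℝ) 1, K x ≤ A)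
    (hKη : ∀ x ∈ Ioc (0:ℝ) ρ, K x ≤ η)
    (hbal : 25/4 * (η * M) + A * (ρ ^ N)⁻¹ ≤ τ * M) {f0 : ℝ → ℝ} (hf0 : Good N K τ M f0) :
    ∃ (v : ℝ → ℝ) (μ : ℝ), 0 < μ ∧ Continuous v ∧ (∀ r ∈ Ico (0:ℝ) 1, 0 < v r) ∧
      ∀ r ∈ Icc (0:ℝ) 1, μ * v r = PG N (fun x => K x * v x ^ Pp N) r := by
  have hK0' : ∀ x ∈ Icc (0:ℝ) 1, 0 ≤ K x := fun x hx => (hK0 x hx).le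
  have hp := Pp_gt hN
  let f : ℕ → ℝ → ℝ := fun n => (PS N K)^[n] f0
  have hfs : ∀ n, f (n + 1) = PS N K (f n) := fun n => Function.iterate_succ_apply' _ _ _
  have step := fun g hg => good_step (f := g) hN hK hK0' hτ hM hA hη hρ hKA hKη hbal hg
  have hgood : ∀ n, Good N K τ M (f n) := by
    intro n
    induction n with
    | zero => exact hf0
    | succ n ih => rw [hfs]; exact (step _ ih).1
  let v : ℕ → ℝ → ℝ := fun n => PG N (f n)
  let Φ : ℕ → ℝ := fun n => PB N (Ph N K (f n)) (f n)
  let t : ℕ → ℝ := fun n => Pt N K (f n)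
  have hΦt : ∀ n, Φ n ≤ t n := fun n => (step _ (hgood n)).2.1
  have hinc : ∀ n, (Pp N + 1) * (t n - Φ n) ≤ Φ (n + 1) - Φ n := by
    intro n
    have := (step _ (hgood n)).2.2.1
    rw [← hfs] at this
    exact this
  have hip : ∀ n, PB N (f (n + 1)) (f n) = (t n)⁻¹ * Φ n := by
    intro n
    have := (step _ (hgood n)).2.2.2
    rw [← hfs] at this
    exact this
  have hΦτ : ∀ n, τ ≤ Φ n := fun n => (hgood n).low
  have htpos : ∀ n, 0 < t n := fun n => by linarith [hΦτ n, hΦt n]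
  set L := τ⁻¹ * (A * M ^ Pp N) with hLdef
  have hL0 : 0 ≤ L := by positivity
  have hlip : ∀ n, ∀ x ∈ Icc (0:ℝ) 1, ∀ y ∈ Icc (0:ℝ) 1,
      |v (n + 1) x - v (n + 1) y| ≤ L * |x - y| := by
    intro n
    have := good_lip hN hK hK0' hτ hM hA hKA (hgood n) (hΦt n)
    rw [← hfs] at this
    exact this
  have hv1 : ∀ n, v n 1 = 0 := fun n => PG_one N _
  have hbd : ∀ n, ∀ x ∈ Icc (0:ℝ) 1, |v (n + 1) x| ≤ L := by
    intro n x hx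
    have := hlip n x hx 1 (by simp)
    rw [hv1, sub_zero] at this
    have h2 : |x - 1| ≤ 1 := by rw [abs_le]; constructor <;> linarith [hx.1, hx.2]
    nlinarith
  have hvn : ∀ n, ∀ x ∈ Icc (0:ℝ) 1, 0 ≤ v n x := fun n x hx => PG_nonneg N (hgood n).nonneg hx
  have hvc : ∀ n, Continuous (v n) := fun n => PG_cont N (hgood n).cont
  obtain ⟨φ, hφ, w, hw, hlim⟩ := extract (fun n => v (n + 1)) hbd hlip
  have hhc : ∀ n, Continuous (Ph N K (f n)) := fun n => Ph_cont hN hK (hgood n).cont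
  have hhb : ∀ n, ∀ x ∈ Icc (0:ℝ) 1, |Ph N K (f (n + 1)) x| ≤ A * L ^ Pp N := by
    intro n x hx
    have h1 := hvn (n + 1) x hx
    have h2 := hbd n x hx
    rw [abs_of_nonneg h1] at h2
    have h3 := Real.rpow_le_rpow h1 h2 (show 0 ≤ Pp N by linarith)
    rw [abs_of_nonneg (Ph_nonneg N hK0' (hgood _).nonneg x hx)]
    have h4 := hKA x hx
    have h5 := Real.rpow_nonneg h1 (Pp N)
    exact mul_le_mul h4 h3 h5 hA
  -- Φ converges
  have hmonoΦ : Monotone (fun n => Φ (n + 1)) := by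
    apply monotone_nat_of_le_succ
    intro n
    have h1 := hinc (n + 1)
    have h2 := hΦt (n + 1)
    nlinarith
  have hΦb : ∀ n, Φ (n + 1) ≤ A * L ^ Pp N * L := by
    intro n
    have := intervalIntegral.norm_integral_le_of_norm_le_const (a := 0) (b := 1)
      (C := A * L ^ Pp N * L)
      (f := fun s => s ^ (N - 1) * (Ph N K (f (n + 1)) s * PG N (f (n + 1)) s)) (by
      intro s hs
      rw [uIoc_of_le zero_le_one] at hs
      have hsI : s ∈ Icc (0:ℝ) 1 := ⟨hs.1.le, hs.2⟩
      rw [Real.norm_eq_abs, abs_mul, abs_mul, abs_pow, abs_of_nonneg hs.1.le]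
      have h1 := hhb n s hsI
      have h2 := hbd n s hsI
      have h3 : s ^ (N - 1) ≤ 1 := pow_le_one₀ hs.1.le hs.2
      have h4 := mul_le_mul h1 h2 (abs_nonneg _) (by positivity)
      have h5 := mul_le_mul h3 h4 (by positivity) zero_le_one
      rw [one_mul] at h5
      exact h5)
    have h2 : |Φ (n + 1)| ≤ A * L ^ Pp N * L := by
      show |PB N _ _| ≤ _
      unfold PB
      simpa using this
    exact (le_abs_self _).trans h2
  obtain ⟨Φl, hΦlim⟩ : ∃ l, Tendsto (fun n => Φ (n + 1)) atTop (nhds l) :=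
    ⟨_, tendsto_atTop_ciSup hmonoΦ ⟨_, by rintro _ ⟨n, rfl⟩; exact hΦb n⟩⟩
  have hΦl : τ ≤ Φl := ge_of_tendsto' hΦlim fun n => hΦτ _
  have hΦl0 : 0 < Φl := by linarith
  have hdiff : Tendsto (fun n => Φ (n + 1 + 1) - Φ (n + 1)) atTop (nhds 0) := by
    have := (hΦlim.comp (tendsto_add_atTop_nat 1)).sub hΦlim
    simpa using this
  have htΦ : Tendsto (fun n => t (n + 1) - Φ (n + 1)) atTop (nhds 0) := by
    apply squeeze_zero (fun n => sub_nonneg.2 (hΦt _)) _ hdiff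
    intro n
    have h1 := hinc (n + 1)
    have h2 := hΦt (n + 1)
    nlinarith
  have htlim : Tendsto (fun n => t (n + 1)) atTop (nhds Φl) := by
    have := htΦ.add hΦlim
    simpa using this
  have hDlim : Tendsto (fun n => 2 - 2 * ((t (n + 1))⁻¹ * Φ (n + 1))) atTop (nhds 0) := by
    have := ((htlim.inv₀ hΦl0.ne').mul hΦlim).const_mul 2
    have := this.const_sub 2
    rw [inv_mul_cancel₀ hΦl0.ne'] at this
    simpa using this
  have hvv : ∀ r ∈ Ioc (0:ℝ) 1, Tendsto (fun n => v (n + 1 + 1) r - v (n + 1) r) atTop (nhds 0) := by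
    intro r hr
    have hsq : Tendsto (fun n => (v (n + 1 + 1) r - v (n + 1) r) ^ 2) atTop (nhds 0) := by
      have h0 := hDlim.mul_const ((r ^ (N - 2))⁻¹)
      rw [zero_mul] at h0
      apply squeeze_zero (fun n => sq_nonneg _) _ h0
      intro n
      have hc1 := (hgood (n + 1 + 1)).cont
      have hc2 := (hgood (n + 1)).cont
      have h1 := PG_pointwise hN (f := fun x => f (n + 1 + 1) x - f (n + 1) x) (hc1.sub hc2) hr.1 hr.2
      rw [PB_sub hN hc1 hc2, PG_sub N hc1 hc2, (hgood _).norm, (hgood _).norm, hip] at h1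
      have hr0 := hr.1
      rw [← div_eq_mul_inv, le_div_iff₀ (by positivity)]
      linarith
    have := hsq.sqrt
    simp only [Real.sqrt_sq_eq_abs, Real.sqrt_zero] at this
    exact (tendsto_zero_iff_abs_tendsto_zero _).2 this
  -- limits along the subsequence
  have hφt := hφ.tendsto_atTop
  have hw0 : ∀ x ∈ Icc (0:ℝ) 1, 0 ≤ w x := fun x hx =>
    ge_of_tendsto' (hlim x hx) fun n => hvn _ x hx
  let H : ℝ → ℝ := fun x => K x * w x ^ Pp N
  have hHc : Continuous H := hK.mul (hw.rpow_const fun x => Or.inr (by linarith))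
  have hHlim : ∀ x ∈ Icc (0:ℝ) 1,
      Tendsto (fun n => Ph N K (f (φ n + 1)) x) atTop (nhds (H x)) := fun x hx =>
    ((hlim x hx).rpow_const (Or.inr (by linarith))).const_mul _
  have heq : ∀ r ∈ Ioc (0:ℝ) 1, Φl * w r = PG N H r := by
    intro r hr
    have hrI : r ∈ Icc (0:ℝ) 1 := ⟨hr.1.le, hr.2⟩
    have h1 := PG_tendsto N (fun n => hhc (φ n + 1)) (fun n => hhb (φ n)) hHlim hrI
    have h2 : Tendsto (fun n => t (φ n + 1) * v (φ n + 1 + 1) r) atTop (nhds (Φl * w r)) := by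
      have h3 : Tendsto (fun n => v (φ n + 1 + 1) r) atTop (nhds (w r)) := by
        have := ((hvv r hr).comp hφt).add (hlim r hrI)
        simpa using this
      exact (htlim.comp hφt).mul h3
    have h4 : ∀ n, t (φ n + 1) * v (φ n + 1 + 1) r = PG N (Ph N K (f (φ n + 1))) r := by
      intro n
      have : v (φ n + 1 + 1) r = (t (φ n + 1))⁻¹ * PG N (Ph N K (f (φ n + 1))) r := by
        show PG N (f (φ n + 1 + 1)) r = _
        rw [hfs (φ n + 1)]
        exact PG_smul N _ _ _
      rw [this, mul_inv_cancel_left₀ (htpos _).ne']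
    simp only [h4] at h2
    exact tendsto_nhds_unique h2 h1
  have hGc := PG_cont N hHc
  have heq' : ∀ r ∈ Icc (0:ℝ) 1, Φl * w r = PG N H r := by
    have hcl : EqOn (fun r => Φl * w r) (PG N H) (closure (Ioc (0:ℝ) 1)) :=
      EqOn.closure heq (by fun_prop) hGc
    rwa [closure_Ioc zero_ne_one] at hcl
  have hHn : ∀ x ∈ Icc (0:ℝ) 1, 0 ≤ H x := fun x hx =>
    mul_nonneg (hK0' x hx) (Real.rpow_nonneg (hw0 x hx) _)
  -- nontriviality
  have hne : ∃ x ∈ Icc (0:ℝ) 1, 0 < x ∧ w x ≠ 0 := by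
    by_contra hcon
    push Not at hcon
    have hlimΦ : Tendsto (fun n => Φ (φ n + 1)) atTop
        (nhds (∫ s in (0:ℝ)..1, s ^ (N - 1) * (H s * w s))) := by
      show Tendsto (fun n => PB N (Ph N K (f (φ n + 1))) (f (φ n + 1))) atTop _
      unfold PB
      have hm : ∀ t ∈ uIoc (0:ℝ) 1, t ∈ Icc (0:ℝ) 1 := by
        intro t ht
        rw [uIoc_of_le zero_le_one] at ht
        exact ⟨ht.1.le, ht.2⟩
      apply intervalIntegral.tendsto_integral_filter_of_dominated_convergence
        (fun _ => A * L ^ Pp N * L)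
      · refine Eventually.of_forall fun n => ?_
        have := hhc (φ n + 1)
        have := hvc (φ n + 1)
        have h3 : Continuous (PG N (f (φ n + 1))) := this
        exact Continuous.aestronglyMeasurable (by fun_prop)
      · refine Eventually.of_forall fun n => ae_of_all _ fun s hs => ?_
        have hsI := hm s hs
        rw [Real.norm_eq_abs, abs_mul, abs_mul, abs_pow, abs_of_nonneg hsI.1]
        have h1 := hhb (φ n) s hsI
        have h2 := hbd (φ n) s hsI
        have h3 : s ^ (N - 1) ≤ 1 := pow_le_one₀ hsI.1 hsI.2
        have h4 := mul_le_mul h1 h2 (abs_nonneg _) (by positivity)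
        have h5 := mul_le_mul h3 h4 (by positivity) zero_le_one
        rw [one_mul] at h5
        exact h5
      · simp
      · refine ae_of_all _ fun s hs => ?_
        exact ((hHlim s (hm s hs)).mul (hlim s (hm s hs))).const_mul _
    have hz : ∫ s in (0:ℝ)..1, s ^ (N - 1) * (H s * w s) = 0 := by
      rw [intervalIntegral.integral_congr (g := fun _ => (0:ℝ))]
      · simp
      intro s hs
      rw [uIcc_of_le zero_le_one] at hs
      rcases eq_or_lt_of_le hs.1 with h0 | h0
      · simp only [← h0]; rw [zero_pow (by omega), zero_mul]
      · simp only [hcon s hs h0, mul_zero]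
    rw [hz] at hlimΦ
    have := tendsto_nhds_unique hlimΦ (hΦlim.comp hφt)
    linarith
  obtain ⟨x0, hx0, hx0p, hwx0⟩ := hne
  have hq1 : 0 < Pq N H 1 := by
    unfold Pq
    apply intervalIntegral.integral_pos zero_lt_one
    · fun_prop
    · intro s hs
      have := hHn s ⟨hs.1.le, hs.2⟩
      rw [one_mul]
      have := hs.1
      positivity
    · refine ⟨x0, hx0, ?_⟩
      rw [one_mul]
      have h1 := lt_of_le_of_ne (hw0 x0 hx0) hwx0.symm
      have h2 := hK0 x0 hx0
      exact mul_pos (by positivity) (mul_pos h2 (Real.rpow_pos_of_pos h1 _))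
  have hqc := Pq_cont N hHc
  refine ⟨w, Φl, hΦl0, hw, ?_, heq'⟩
  intro r hr
  have h1 : 0 < PG N H r := by
    unfold PG
    apply intervalIntegral.integral_pos hr.2
    · fun_prop
    · intro s hs
      have hsI : s ∈ Icc (0:ℝ) 1 := ⟨hr.1.trans hs.1.le, hs.2⟩
      exact mul_nonneg hsI.1 (Pq_nonneg N hHn hsI)
    · exact ⟨1, ⟨hr.2.le, le_rfl⟩, by rw [one_mul]; exact hq1⟩
  rw [← heq' r ⟨hr.1, hr.2.le⟩] at h1
  exact pos_of_mul_pos_right h1 hΦl0.le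

lemma Pq_const {N : ℕ} (hN : 3 ≤ N) (c s : ℝ) : Pq N (fun _ => c) s = c / N := by
  unfold Pq
  rw [intervalIntegral.integral_mul_const, integral_pow]
  have : ((N - 1 : ℕ) : ℝ) + 1 = N := by
    rw [Nat.cast_sub (by omega)]; simp
  rw [this, Nat.sub_add_cancel (by omega)]
  rw [zero_pow (by omega)]
  simp; ring

lemma PG_const {N : ℕ} (hN : 3 ≤ N) (c r : ℝ) :
    PG N (fun _ => c) r = c / N * ((1 - r ^ 2) / 2) := by
  unfold PG
  simp only [Pq_const hN]
  rw [intervalIntegral.integral_mul_const, integral_id]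
  ring

lemma main1D {N : ℕ} (hN : 3 ≤ N) {κ : ℝ → ℝ} (hκ : Continuous κ)
    (hκ0 : ∀ x ∈ Icc (0:ℝ) 1, 0 ≤ κ x) (hκz : κ 0 = 0) (hκp : ∃ x ∈ Icc (0:ℝ) 1, 0 < κ x) :
    ∃ Λ : ℝ, 0 < Λ ∧ ∀ lam : ℝ, Λ < lam → 
    ∃ (v : ℝ → ℝ) (μ : ℝ), 0 < μ ∧ Continuous v ∧ (∀ r ∈ Ico (0:ℝ) 1, 0 < v r) ∧
      ∀ r ∈ Icc (0:ℝ) 1, μ * v r = PG N (fun x => (lam⁻¹ + κ x) * v x ^ Pp N) r := by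
  have hNR : (3:ℝ) ≤ N := by exact_mod_cast hN
  have hp := Pp_gt hN
  have hs1 : ∃ s ∈ Ioo (0:ℝ) 1, 0 < κ s := by
    obtain ⟨r, hr, hrp⟩ := hκp
    have hcl : r ∈ closure (Ioo (0:ℝ) 1) := by rwa [closure_Ioo zero_ne_one]
    obtain ⟨s, h1, h2⟩ := mem_closure_iff.1 hcl {x | 0 < κ x}
      (isOpen_lt continuous_const hκ) hrp
    exact ⟨s, h2, h1⟩
  obtain ⟨s1, hs1, hs1p⟩ := hs1
  have hone : Continuous (fun _ : ℝ => (1:ℝ)) := continuous_const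
  have hG1 := PG_cont N hone
  have hB1 : 0 < PB N (fun _ => 1) (fun _ => 1) := by
    unfold PB
    apply intervalIntegral.integral_pos zero_lt_one
    · fun_prop
    · intro s hs
      have := PG_nonneg N (f := fun _ => 1) (fun _ _ => zero_le_one) ⟨hs.1.le, hs.2⟩
      have := hs.1
      positivity
    · refine ⟨s1, ⟨hs1.1.le, hs1.2.le⟩, ?_⟩
      rw [PG_const hN]
      have := hs1.1
      have : 0 < 1 - s1 ^ 2 := by nlinarith [hs1.1, hs1.2]
      positivity
  set c0 : ℝ := (Real.sqrt (PB N (fun _ => 1) (fun _ => 1)))⁻¹ with hc0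
  have hc0p : 0 < c0 := by positivity
  set f0 : ℝ → ℝ := fun _ => c0 with hf0
  have hf0c : Continuous f0 := continuous_const
  have hf0n : ∀ x ∈ Icc (0:ℝ) 1, 0 ≤ f0 x := fun _ _ => hc0p.le
  have hf0norm : PB N f0 f0 = 1 := by
    have e : f0 = fun x => c0 * (fun _ => (1:ℝ)) x := by ext; simp [hf0]
    rw [e, PB_smul_left, PB_smul_right]
    have := Real.mul_self_sqrt hB1.le
    have h2 : Real.sqrt (PB N (fun _ => 1) (fun _ => 1)) ≠ 0 := by positivity
    rw [hc0]
    nth_rewrite 3 [← this]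
    field_simp
  have hGc := PG_cont N hf0c
  have hPc := Ph_cont hN hκ hf0c
  set τ := PB N (Ph N κ f0) f0 with hτdef
  have hτ : 0 < τ := by
    rw [hτdef]
    unfold PB
    apply intervalIntegral.integral_pos zero_lt_one
    · fun_prop
    · intro s hs
      have h1 := PG_nonneg N hf0n ⟨hs.1.le, hs.2⟩
      have h2 := Ph_nonneg N hκ0 hf0n s ⟨hs.1.le, hs.2⟩
      have := hs.1
      positivity
    · refine ⟨s1, ⟨hs1.1.le, hs1.2.le⟩, ?_⟩
      have h0 := hs1.1
      have : 0 < 1 - s1 ^ 2 := by nlinarith [hs1.1, hs1.2]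
      have h1 : 0 < PG N f0 s1 := by
        rw [hf0, PG_const hN]
        positivity
      unfold Ph
      positivity
  obtain ⟨A0, hA0⟩ := isCompact_Icc.exists_bound_of_continuousOn (s := Icc (0:ℝ) 1) hκ.continuousOn
  have hA0' : 0 ≤ A0 := (norm_nonneg _).trans (hA0 0 (by simp))
  set A := 1 + A0 with hA
  set η := 2 * τ / 25 with hη
  have hηp : 0 < η := by positivity
  obtain ⟨ρ, hρ, hρκ⟩ : ∃ ρ > 0, ∀ x ∈ Ioc (0:ℝ) ρ, κ x ≤ η / 2 := by
    obtain ⟨δ, hδ, h⟩ := Metric.continuous_iff.1 hκ 0 (η / 2) (by positivity)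
    refine ⟨δ / 2, by positivity, fun x hx => ?_⟩
    have := h x (by rw [Real.dist_eq, sub_zero, abs_of_pos hx.1]; linarith [hx.2])
    rw [hκz, Real.dist_eq, sub_zero] at this
    exact ((le_abs_self _).trans_lt this).le
  set M := c0 + 2 * (A * (ρ ^ N)⁻¹) / τ with hMdef
  have hX : 0 ≤ A * (ρ ^ N)⁻¹ := by positivity
  have hM0 : 0 ≤ 2 * (A * (ρ ^ N)⁻¹) / τ := by positivity
  have hM : 0 ≤ M := by positivity
  refine ⟨max 1 (2 / η), by positivity, fun lam hlam => ?_⟩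
  have hl1 : 1 < lam := (le_max_left _ _).trans_lt hlam
  have hl2 : 2 / η < lam := (le_max_right _ _).trans_lt hlam
  have hl0 : 0 < lam := by linarith
  have hli1 : lam⁻¹ ≤ 1 := inv_le_one_of_one_le₀ hl1.le
  have hli2 : lam⁻¹ ≤ η / 2 := by
    rw [div_lt_iff₀ hηp] at hl2
    rw [inv_le_iff_one_le_mul₀ hl0]
    linarith
  have hli0 : 0 < lam⁻¹ := by positivity
  have hKc : Continuous (fun x => lam⁻¹ + κ x) := by fun_prop
  have hPc' := Ph_cont hN hKc hf0c
  refine exists_fixed hN (K := fun x => lam⁻¹ + κ x) hKc ?_ (τ := τ) (M := M)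
    (A := A) (η := η) (ρ := ρ) hτ hM (by positivity) hηp.le hρ ?_ ?_ ?_ (f0 := f0) ?_
  · intro x hx; linarith [hκ0 x hx]
  · intro x hx
    have := (le_abs_self _).trans (hA0 x hx)
    linarith
  · intro x hx
    linarith [hρκ x hx]
  · have e1 : 25/4 * (η * M) = τ * M / 2 := by rw [hη]; ring
    have e2 : τ * M = τ * c0 + 2 * (A * (ρ ^ N)⁻¹) := by rw [hMdef]; field_simp
    have e3 : 0 < τ * c0 := by positivity
    rw [e1]
    linarith
  · refine ⟨hf0c, hf0n, hf0norm, ?_, ?_⟩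
    · rw [hτdef]
      unfold PB
      apply intervalIntegral.integral_mono_on (by norm_num)
        (Continuous.intervalIntegrable (by fun_prop) _ _)
        (Continuous.intervalIntegrable (by fun_prop) _ _)
      intro s hs
      have h1 := PG_nonneg N hf0n hs
      have h2 := Real.rpow_nonneg h1 (Pp N)
      have h3 := hs.1
      have h4 : Ph N κ f0 s ≤ Ph N (fun x => lam⁻¹ + κ x) f0 s := by
        unfold Ph
        apply mul_le_mul_of_nonneg_right _ h2
        simp only
        linarith
      gcongr
    · intro x hx
      have h2 : 1 ≤ x ^ (-(1/5) : ℝ) :=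
        Real.one_le_rpow_of_pos_of_le_one_of_nonpos hx.1 hx.2 (by norm_num)
      have h3 : PG N f0 x ≤ c0 := by
        rw [hf0, PG_const hN]
        have h4 : c0 / N ≤ c0 := div_le_self hc0p.le (by linarith)
        have h5 : (1 - x ^ 2) / 2 ≤ 1 := by nlinarith [sq_nonneg x]
        have h6 : 0 ≤ c0 / N := by positivity
        nlinarith
      have h7 : c0 ≤ M := by rw [hMdef]; linarith
      nlinarith

lemma PG_sq {N : ℕ} {f : ℝ → ℝ} (hf : Continuous f) {r : ℝ} (hr : 0 ≤ r) :
    PG N f r = ∫ y in (r ^ 2)..1, Pq N f (Real.sqrt y) * (1 / 2) := by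
  have hq := Pq_cont N hf
  have h := intervalIntegral.integral_comp_mul_deriv (a := r) (b := 1) (f := fun s => s ^ 2)
    (f' := fun s => 2 * s) (g := fun y => Pq N f (Real.sqrt y) * (1 / 2))
    (fun x _ => by simpa using hasDerivAt_pow 2 x) (by fun_prop)
    (by have := Real.continuous_sqrt
        fun_prop)
  rw [one_pow] at h
  rw [← h]
  unfold PG
  apply intervalIntegral.integral_congr
  intro s hs
  have hs0 : 0 ≤ s := by
    have := hs.1
    exact le_trans (le_min hr zero_le_one) this
  simp only [Function.comp, Real.sqrt_sq hs0]
  ring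

lemma Pq_deriv {N : ℕ} (hN : 3 ≤ N) {f : ℝ → ℝ} (hf : Continuous f) {r : ℝ} (hr : 0 < r) :
    HasDerivAt (Pq N f) ((f r - N * Pq N f r) / r) r := by
  have h1 := (PF_deriv N hf r).div (hasDerivAt_pow N r) (by positivity)
  have h2 : Pq N f =ᶠ[nhds r] (PF N f / fun x => x ^ N) := by
    filter_upwards [lt_mem_nhds hr] with s hs
    show _ = PF N f s / s ^ N
    rw [← Pq_PF hN]
    field_simp
  refine (h1.congr_of_eventuallyEq h2).congr_deriv ?_
  rw [← Pq_PF hN]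
  have : r ^ N = r ^ (N - 1) * r := by rw [← pow_succ]; congr 1; omega
  rw [this]
  field_simp

noncomputable def Lin (N : ℕ) : EuclideanSpace ℝ (Fin N) →L[ℝ] EuclideanSpace ℝ (Fin N) →L[ℝ] ℝ :=
  (isBoundedBilinearMap_inner (𝕜 := ℝ) (E := EuclideanSpace ℝ (Fin N))).toContinuousLinearMap

lemma Lin_apply {N : ℕ} (x y : EuclideanSpace ℝ (Fin N)) : Lin N x y = inner ℝ x y := rfl

lemma Lin_eq {N : ℕ} (x : EuclideanSpace ℝ (Fin N)) : Lin N x = innerSL ℝ x := by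
  ext y; rfl

lemma Lin_norm {N : ℕ} (x : EuclideanSpace ℝ (Fin N)) : ‖Lin N x‖ = ‖x‖ := by
  rw [Lin_eq]; exact innerSL_apply_norm ℝ x

lemma rad_fderiv {N : ℕ} {f : ℝ → ℝ} (hf : Continuous f) (x : EuclideanSpace ℝ (Fin N)) :
    HasFDerivAt (fun x : EuclideanSpace ℝ (Fin N) => PG N f ‖x‖) (-(Pq N f ‖x‖ • Lin N x)) x := by
  have hq := Pq_cont N hf
  have hc : Continuous (fun y : ℝ => Pq N f (Real.sqrt y) * (1 / 2)) := by
    have := Real.continuous_sqrt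
    fun_prop
  have h1 : HasDerivAt (fun z : ℝ => ∫ y in z..1, Pq N f (Real.sqrt y) * (1 / 2))
      (-(Pq N f (Real.sqrt (‖x‖ ^ 2)) * (1 / 2))) (‖x‖ ^ 2) :=
    intervalIntegral.integral_hasDerivAt_left (hc.intervalIntegrable _ _)
      hc.stronglyMeasurable.stronglyMeasurableAtFilter hc.continuousAt
  have h2 := h1.comp_hasFDerivAt x (hasStrictFDerivAt_norm_sq x).hasFDerivAt
  have e : (fun x : EuclideanSpace ℝ (Fin N) => PG N f ‖x‖) =
      (fun z : ℝ => ∫ y in z..1, Pq N f (Real.sqrt y) * (1 / 2)) ∘ (fun x => ‖x‖ ^ 2) := by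
    ext y
    exact PG_sq hf (norm_nonneg y)
  rw [e]
  refine h2.congr_fderiv ?_
  rw [Real.sqrt_sq (norm_nonneg x), Lin_eq]
  ext y
  simp
  ring

noncomputable def cc (N : ℕ) (f : ℝ → ℝ) (r : ℝ) : ℝ := (f r - N * Pq N f r) * (r ^ 2)⁻¹

noncomputable def MM (N : ℕ) (x : EuclideanSpace ℝ (Fin N)) :
    EuclideanSpace ℝ (Fin N) →L[ℝ] EuclideanSpace ℝ (Fin N) →L[ℝ] ℝ :=
  (Lin N x).smulRight (Lin N x)

lemma MM_apply {N : ℕ} (x y z : EuclideanSpace ℝ (Fin N)) :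
    MM N x y z = inner ℝ x y * inner ℝ x z := by
  simp [MM, Lin_apply]

lemma MM_norm {N : ℕ} (x : EuclideanSpace ℝ (Fin N)) : ‖MM N x‖ = ‖x‖ * ‖x‖ := by
  unfold MM
  rw [ContinuousLinearMap.norm_smulRight_apply, Lin_norm]

lemma MM_cont (N : ℕ) : Continuous (MM N) := by
  have hL : Continuous (fun x => Lin N x) := (Lin N).continuous
  exact ((ContinuousLinearMap.smulRightL ℝ (EuclideanSpace ℝ (Fin N))
        (EuclideanSpace ℝ (Fin N) →L[ℝ] ℝ)).continuous.comp hL).clm_apply hL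

noncomputable def DD (N : ℕ) (f : ℝ → ℝ) (x : EuclideanSpace ℝ (Fin N)) :
    EuclideanSpace ℝ (Fin N) →L[ℝ] EuclideanSpace ℝ (Fin N) →L[ℝ] ℝ :=
  Pq N f ‖x‖ • Lin N + cc N f ‖x‖ • MM N x

lemma Pq_zero {N : ℕ} (hN : 3 ≤ N) (f : ℝ → ℝ) : Pq N f 0 = f 0 / N := by
  have := Pq_const hN (f 0) 0
  unfold Pq at *
  simpa using this

lemma abs_cont {E V : Type*} [NormedAddCommGroup E] [NormedAddCommGroup V] [NormedSpace ℝ V]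
    (a c h : E → ℝ) (L : V) (M : E → V) (ha : Continuous a) (hc : ∀ x, x ≠ 0 → ContinuousAt c x)
    (hM : Continuous M) (hM0 : M 0 = 0) (hlim : Tendsto h (nhds 0) (nhds 0))
    (hb : ∀ y, |c y| * ‖M y‖ ≤ h y) : Continuous (fun x => a x • L + c x • M x) := by
  have hA : Continuous (fun x => a x • L) := ha.smul continuous_const
  have hB : Continuous (fun x => c x • M x) := by
    rw [continuous_iff_continuousAt]
    intro x
    by_cases hx : x = 0
    · subst hx
      have h1 : Tendsto (fun x => c x • M x) (nhds 0) (nhds 0) := by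
        apply squeeze_zero_norm _ hlim
        intro y
        rw [norm_smul, Real.norm_eq_abs]
        exact hb y
      have h2 : c 0 • M 0 = 0 := by rw [hM0, smul_zero]
      unfold ContinuousAt
      simp only [h2]
      exact h1
    · exact (hc x hx).smul hM.continuousAt
  exact hA.add hB

lemma DD_cont {N : ℕ} (hN : 3 ≤ N) {f : ℝ → ℝ} (hf : Continuous f) : Continuous (DD N f) := by
  have hq := Pq_cont N hf
  have hNR : (3:ℝ) ≤ N := by exact_mod_cast hN
  have hq2 : Continuous (fun x : EuclideanSpace ℝ (Fin N) => Pq N f ‖x‖) :=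
    hq.comp continuous_norm
  have hM0 : MM N 0 = 0 := by ext y z; simp [MM_apply]
  refine abs_cont (fun x : EuclideanSpace ℝ (Fin N) => Pq N f ‖x‖) (fun x => cc N f ‖x‖)
    (fun x => |f ‖x‖ - N * Pq N f ‖x‖|) (Lin N) (MM N) hq2 ?_ (MM_cont N) hM0 ?_ ?_
  · intro x hx
    have hn : ‖x‖ ^ 2 ≠ 0 := by simpa using hx
    unfold cc
    refine ContinuousAt.mul ?_ (ContinuousAt.inv₀ (by fun_prop) hn)
    exact Continuous.continuousAt (by fun_prop)
  · have hc : Continuous (fun x : EuclideanSpace ℝ (Fin N) => |f ‖x‖ - N * Pq N f ‖x‖|) := by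
      fun_prop
    have := hc.tendsto 0
    rw [norm_zero, Pq_zero hN] at this
    have e : |f 0 - N * (f 0 / N)| = 0 := by
      field_simp
      simp
    rwa [e] at this
  · intro y
    rw [MM_norm]
    unfold cc
    rw [abs_mul, mul_assoc]
    apply mul_le_of_le_one_right (abs_nonneg _)
    rw [abs_inv, abs_pow, abs_norm]
    by_cases hy : ‖y‖ = 0
    · simp [hy]
    · rw [← sq, inv_mul_cancel₀ (by positivity)]

set_option synthInstance.maxHeartbeats 400000 in
set_option maxHeartbeats 1000000 in
lemma grad_fderiv {N : ℕ} (hN : 3 ≤ N) {f : ℝ → ℝ} (hf : Continuous f)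
    (x : EuclideanSpace ℝ (Fin N)) :
    HasFDerivAt (fun x : EuclideanSpace ℝ (Fin N) => Pq N f ‖x‖ • Lin N x) (DD N f x) x := by
  have hq := Pq_cont N hf
  by_cases hx : x = 0
  · subst hx
    have e : DD N f 0 = Pq N f 0 • Lin N := by
      ext y z; simp [DD, MM_apply, Lin_apply]
    rw [e, hasFDerivAt_iff_isLittleO_nhds_zero]
    simp only [zero_add, map_zero, smul_zero, sub_zero, ContinuousLinearMap.smul_apply]
    have h1 : Tendsto (fun h : EuclideanSpace ℝ (Fin N) => Pq N f ‖h‖ - Pq N f 0) (nhds 0)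
        (nhds 0) := by
      have hc : Continuous (fun h : EuclideanSpace ℝ (Fin N) => Pq N f ‖h‖ - Pq N f 0) := by
        fun_prop
      simpa using hc.tendsto 0
    have h2 := (Asymptotics.isLittleO_one_iff ℝ).2 h1
    have h3 : (fun h : EuclideanSpace ℝ (Fin N) => Lin N h) =O[nhds 0] fun h => h :=
      (Lin N).isBigO_id _
    have h4 := h2.smul_isBigO h3
    simpa [sub_smul] using h4
  · have hxp : 0 < ‖x‖ := norm_pos_iff.2 hx
    have h1 : HasFDerivAt (fun x : EuclideanSpace ℝ (Fin N) => Real.sqrt (‖x‖ ^ 2))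
        ((1 / (2 * Real.sqrt (‖x‖ ^ 2))) • (2 • innerSL ℝ x)) x :=
      (hasStrictFDerivAt_norm_sq x).hasFDerivAt.sqrt (by positivity)
    have e1 : (fun x : EuclideanSpace ℝ (Fin N) => Real.sqrt (‖x‖ ^ 2)) = fun x => ‖x‖ := by
      ext y; exact Real.sqrt_sq (norm_nonneg y)
    rw [e1, Real.sqrt_sq (norm_nonneg x)] at h1
    have h2 := (Pq_deriv hN hf hxp).comp_hasFDerivAt x h1
    have h3 := h2.smul (Lin N).hasFDerivAt
    refine h3.congr_fderiv ?_
    unfold DD cc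
    ext y z
    simp [Lin_apply, MM_apply]
    field_simp
    
lemma rad_contDiff {N : ℕ} (hN : 3 ≤ N) {f : ℝ → ℝ} (hf : Continuous f) :
    ContDiff ℝ 2 (fun x : EuclideanSpace ℝ (Fin N) => PG N f ‖x‖) := by
  have h1 : ContDiff ℝ 1 (fun x : EuclideanSpace ℝ (Fin N) => -(Pq N f ‖x‖ • Lin N x)) :=
    (contDiff_one_iff_hasFDerivAt.2 ⟨DD N f, DD_cont hN hf, grad_fderiv hN hf⟩).neg
  have := (contDiff_succ_iff_hasFDerivAt (𝕜 := ℝ) (n := 1)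
    (f := fun x : EuclideanSpace ℝ (Fin N) => PG N f ‖x‖)).2 ⟨_, h1, rad_fderiv hf⟩
  norm_num at this
  exact this

set_option synthInstance.maxHeartbeats 400000 in
set_option maxHeartbeats 1000000 in
lemma rad_laplacian {N : ℕ} (hN : 3 ≤ N) {f : ℝ → ℝ} (hf : Continuous f)
    (x : EuclideanSpace ℝ (Fin N)) :
    laplacian (fun x : EuclideanSpace ℝ (Fin N) => PG N f ‖x‖) x = - f ‖x‖ := by
  have hNR : (3:ℝ) ≤ N := by exact_mod_cast hN
  unfold laplacian
  have h1 : ∀ i, fderiv ℝ (fun y => fderiv ℝ (fun x : EuclideanSpace ℝ (Fin N) => PG N f ‖x‖) y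
      (EuclideanSpace.single i (1:ℝ))) x (EuclideanSpace.single i (1:ℝ)) =
      -(Pq N f ‖x‖ + cc N f ‖x‖ * x i ^ 2) := by
    intro i
    have e : (fun y => fderiv ℝ (fun x : EuclideanSpace ℝ (Fin N) => PG N f ‖x‖) y
      (EuclideanSpace.single i (1:ℝ))) =
      fun y => (-(Pq N f ‖y‖ • Lin N y)) (EuclideanSpace.single i (1:ℝ)) := by
      ext y
      rw [(rad_fderiv hf y).fderiv]
    rw [e]
    have h2 := (grad_fderiv hN hf x).neg.clm_apply
      (hasFDerivAt_const (EuclideanSpace.single i (1:ℝ)) x)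
    have h3 := h2.fderiv
    simp only [Pi.neg_apply] at h3
    rw [h3]
    simp [DD, MM_apply, Lin_apply, EuclideanSpace.inner_single_right]
    ring_nf
    simp
  simp only [h1]
  rw [Finset.sum_neg_distrib, Finset.sum_add_distrib, ← Finset.mul_sum]
  have h4 : ∑ i, x i ^ 2 = ‖x‖ ^ 2 := by
    rw [EuclideanSpace.norm_sq_eq]
    simp
  rw [h4]
  simp only [Finset.sum_const, Finset.card_univ, Fintype.card_fin, nsmul_eq_mul]
  unfold cc
  by_cases hx : ‖x‖ = 0
  · rw [hx, Pq_zero hN]; field_simp; simp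
  · field_simp; ring

theorem stmt_6 (N : ℕ) (hN : 3 ≤ N) (k : EuclideanSpace ℝ (Fin N) → ℝ)
    (hk_nonneg : ∀ x, 0 ≤ k x)
    (hk_radial : ∀ x y : EuclideanSpace ℝ (Fin N), ‖x‖ = ‖y‖ → k x = k y)
    (hk_holder : ∃ C α : ℝ≥0, 0 < α ∧ α ≤ 1 ∧
      HolderOnWith C α k (closedBall (0 : EuclideanSpace ℝ (Fin N)) 1))
    (hk0 : k 0 = 0)
    (hk_pos : ∃ x₀ ∈ closedBall (0 : EuclideanSpace ℝ (Fin N)) 1, 0 < k x₀) :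
    ∃ lamstar : ℝ, 0 < lamstar ∧ ∀ lam : ℝ, lamstar < lam →
      ∃ u : EuclideanSpace ℝ (Fin N) → ℝ,
        (∀ x y : EuclideanSpace ℝ (Fin N), ‖x‖ = ‖y‖ → u x = u y) ∧
        ContinuousOn u (closedBall 0 1) ∧
        ContDiffOn ℝ 2 u (ball 0 1) ∧
        (∀ x ∈ ball (0 : EuclideanSpace ℝ (Fin N)) 1, 0 < u x) ∧
        (∀ x ∈ sphere (0 : EuclideanSpace ℝ (Fin N)) 1, u x = 0) ∧
        (∀ x ∈ ball (0 : EuclideanSpace ℝ (Fin N)) 1,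
          -laplacian u x = (1 + lam * k x) * u x ^ (((N : ℝ) + 2) / ((N : ℝ) - 2))) := by
  have hNR : (3:ℝ) ≤ N := by exact_mod_cast hN
  set e1 : EuclideanSpace ℝ (Fin N) := EuclideanSpace.single ⟨0, by omega⟩ (1:ℝ) with he1
  have hen : ‖e1‖ = 1 := by simp [he1]
  set κ : ℝ → ℝ := fun r => k ((max 0 (min r 1)) • e1) with hκd
  have hcl : ∀ r : ℝ, 0 ≤ max 0 (min r 1) ∧ max 0 (min r 1) ≤ 1 := fun r =>
    ⟨le_max_left _ _, max_le zero_le_one (min_le_right _ _)⟩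
  have hnorm : ∀ r : ℝ, ‖(max 0 (min r 1)) • e1‖ = max 0 (min r 1) := by
    intro r
    rw [norm_smul, hen, mul_one, Real.norm_eq_abs, abs_of_nonneg (hcl r).1]
  have hκ : Continuous κ := by
    obtain ⟨C, α, hα, -, hH⟩ := hk_holder
    have hc := hH.continuousOn hα
    refine hc.comp_continuous (f := fun r : ℝ => (max 0 (min r 1)) • e1) (by fun_prop) ?_
    intro r
    rw [mem_closedBall_zero_iff, hnorm]
    exact (hcl r).2
  have hκk : ∀ x : EuclideanSpace ℝ (Fin N), ‖x‖ ≤ 1 → κ ‖x‖ = k x := by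
    intro x hx
    apply hk_radial
    rw [hnorm, min_eq_left hx, max_eq_right (norm_nonneg x)]
  have hκz : κ 0 = 0 := by
    have := hκk 0 (by simp)
    rw [norm_zero] at this
    rw [this, hk0]
  obtain ⟨x₀, hx₀, hkx₀⟩ := hk_pos
  rw [mem_closedBall_zero_iff] at hx₀
  obtain ⟨Λ, hΛ, hmain⟩ := main1D hN hκ (fun x _ => hk_nonneg _) hκz
    ⟨‖x₀‖, ⟨norm_nonneg _, hx₀⟩, by rw [hκk x₀ hx₀]; exact hkx₀⟩
  refine ⟨Λ, hΛ, fun lam hlam => ?_⟩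
  have hl : 0 < lam := hΛ.trans hlam
  obtain ⟨v, μ, hμ, hv, hvp, hveq⟩ := hmain lam hlam
  have hp := Pp_gt hN
  set H : ℝ → ℝ := fun x => (lam⁻¹ + κ x) * v x ^ Pp N with hHd
  have hH : Continuous H :=
    (continuous_const.add hκ).mul (hv.rpow_const fun x => Or.inr (by linarith))
  set c : ℝ := ((μ * lam)⁻¹) ^ (1 / (Pp N - 1)) with hcd
  have hml : 0 < (μ * lam)⁻¹ := by positivity
  have hc0 : 0 < c := Real.rpow_pos_of_pos hml _
  have hcp : c ^ Pp N = c * μ⁻¹ * lam⁻¹ := by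
    have h1 : c ^ (Pp N - 1) = (μ * lam)⁻¹ := by
      rw [hcd, ← Real.rpow_mul hml.le, one_div_mul_cancel (by linarith), Real.rpow_one]
    have h2 : c ^ Pp N = c ^ (Pp N - 1) * c := by
      rw [← Real.rpow_add_one hc0.ne']
      congr 1; ring
    rw [h2, h1, mul_inv]; ring
  have hF : Continuous (fun s => (c * μ⁻¹) * H s) := continuous_const.mul hH
  have hu : ∀ x : EuclideanSpace ℝ (Fin N), ‖x‖ ≤ 1 →
      PG N (fun s => (c * μ⁻¹) * H s) ‖x‖ = c * v ‖x‖ := by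
    intro x hx
    rw [PG_smul, ← hveq ‖x‖ ⟨norm_nonneg _, hx⟩]
    field_simp
  have hC := rad_contDiff hN hF
  refine ⟨fun x => PG N (fun s => (c * μ⁻¹) * H s) ‖x‖, ?_, hC.continuous.continuousOn,
    hC.contDiffOn, ?_, ?_, ?_⟩
  · intro x y hxy
    simp only [hxy]
  · intro x hx
    rw [mem_ball_zero_iff] at hx
    simp only [hu x hx.le]
    exact mul_pos hc0 (hvp _ ⟨norm_nonneg _, hx⟩)
  · intro x hx
    rw [mem_sphere_zero_iff_norm] at hx
    simp only [hx, PG_one]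
  · intro x hx
    rw [mem_ball_zero_iff] at hx
    rw [rad_laplacian hN hF]
    simp only [hu x hx.le]
    change _ = _ * _ ^ Pp N
    rw [Real.mul_rpow hc0.le (hvp _ ⟨norm_nonneg _, hx⟩).le, hcp]
    simp only [hHd]
    rw [hκk x hx.le]
    field_simp
end

section
/- Let N ≥ 3, let B be the open unit ball in ℝ^N, and let β > N−2. Set λ_* = (2(N−1)/(N−2)) · ((2N−2+β)/(β−N+2))^((β−N+2)/(N−2)). Then for every λ ∈ [0, λ_*] there is no radial function u, continuously differentiable on the closed unit ball and twice continuously differentiable on B, with u > 0 in B and u = 0 on the unit sphere, satisfying −Δu(x) = (1 + λ·|x|^β)·u(x)^((N+2)/(N−2)) for all x ∈ B. -/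
open scoped NNReal
open MeasureTheory Filter Set Metric

lemma aux_bern (c t : ℝ) (hc : 0 < c) (ht : 0 < t) :
    (c + 1) * t ^ c - c * t ^ (c + 1) ≤ 1 := by
  have h := one_add_mul_self_le_rpow_one_add (s := t⁻¹ - 1) (by have := inv_pos.2 ht; linarith)
    (p := c + 1) (by linarith)
  have e : 1 + (t⁻¹ - 1) = t⁻¹ := by ring
  rw [e, Real.inv_rpow ht.le] at h
  have hp : 0 < t ^ (c + 1) := Real.rpow_pos_of_pos ht _
  have h2 := mul_le_mul_of_nonneg_left h hp.le
  rw [mul_inv_cancel₀ hp.ne'] at h2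
  rw [Real.rpow_add_one ht.ne'] at h2 ⊢
  have h3 : t ^ c * t * (1 + (c + 1) * (t⁻¹ - 1)) = (c + 1) * t ^ c - c * (t ^ c * t) := by
    field_simp
    ring
  linarith

/-- the key inequality -/
lemma aux_key (M β lam ρ : ℝ) (hM : 0 < M) (hβ : M < β) (hl : 0 ≤ lam)
    (hlam : lam ≤ 2 * (M + 1) / M * ((2 * M + 2 + β) / (β - M)) ^ ((β - M) / M)) (hρ : 0 < ρ) :
    lam * (β * ρ ^ ((β - M) / M) - (β + 2 * M + 2) * (ρ ^ ((β - M) / M) * ρ)) ≤ 2 * (M + 1) := by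
  set c := (β - M) / M with hc
  have hd : 0 < β - M := by linarith
  have hm : 0 < 2 * M + 2 + β := by linarith
  have hcpos : 0 < c := div_pos hd hM
  set T := (2 * M + 2 + β) / (β - M) with hT
  have hTpos : 0 < T := div_pos hm hd
  have hb := aux_bern c (T * ρ) hcpos (mul_pos hTpos hρ)
  rw [Real.rpow_add_one (mul_pos hTpos hρ).ne', Real.mul_rpow hTpos.le hρ.le] at hb
  have hTc : 0 < T ^ c := Real.rpow_pos_of_pos hTpos _
  have hbeta : β = M * (c + 1) := by rw [hc]; field_simp; ring
  have hmm : β + 2 * M + 2 = M * c * T := by rw [hc, hT]; field_simp; ring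
  have h1 : T ^ c * (β * ρ ^ c - (β + 2 * M + 2) * (ρ ^ c * ρ)) ≤ M := by
    have : T ^ c * (β * ρ ^ c - (β + 2 * M + 2) * (ρ ^ c * ρ))
        = M * ((c + 1) * (T ^ c * ρ ^ c) - c * (T ^ c * ρ ^ c * (T * ρ))) := by
      rw [hmm]; nth_rewrite 1 [hbeta]; ring
    rw [this]; nlinarith
  set X := β * ρ ^ c - (β + 2 * M + 2) * (ρ ^ c * ρ)
  rcases le_or_gt X 0 with hX | hX
  · nlinarith
  · calc lam * X ≤ 2 * (M + 1) / M * T ^ c * X := by gcongr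
      _ = 2 * (M + 1) / M * (T ^ c * X) := by ring
      _ ≤ 2 * (M + 1) / M * M := by gcongr
      _ = _ := by field_simp

lemma aux_ode (n : ℕ) (β lam : ℝ) (hβ : (n : ℝ) + 1 < β) (hl : 0 ≤ lam)
    (hlam : lam ≤ 2 * ((n + 1 : ℝ) + 1) / (n + 1 : ℝ) *
      ((2 * (n + 1 : ℝ) + 2 + β) / (β - (n + 1 : ℝ))) ^ ((β - (n + 1 : ℝ)) / (n + 1 : ℝ)))
    (v W : ℝ → ℝ) (hv : ContinuousOn v (Icc 0 1)) (hW : ContinuousOn W (Icc 0 1))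
    (hv' : ∀ r ∈ Ioo (0 : ℝ) 1, HasDerivAt v (W r) r)
    (hW' : ∀ r ∈ Ioo (0 : ℝ) 1, HasDerivAt W
      (-((n + 2 : ℝ) * (W r / r)) - (1 + lam * r ^ β) * v r ^ ((n + 5 : ℝ) / (n + 1))) r)
    (hpos : ∀ r ∈ Ioo (0 : ℝ) 1, 0 < v r) (hv1 : v 1 = 0) : False := by
  have hn : (0 : ℝ) ≤ n := Nat.cast_nonneg n
  have hβ0 : 0 < β := by linarith
  set q : ℝ := (n + 5 : ℝ) / (n + 1) with hq
  have hq0 : 0 < q := by positivity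
  have hq1 : q + 1 = 2 * (n + 3) / (n + 1) := by rw [hq]; field_simp; ring
  set F : ℝ → ℝ := fun r => (1 / 2) * (r ^ (n + 3) - r ^ (2 * n + 4)) * W r ^ 2
    + (n + 1) / 2 * r ^ (n + 2) * v r * W r
    + (r ^ (n + 3) - r ^ (2 * n + 4)) * (1 + lam * r ^ β) * v r ^ (q + 1) / (q + 1) with hF
  set G : ℝ → ℝ := fun r => (1 - r ^ (n + 1)) * (lam * β * r ^ β)
    - 2 * (n + 2) * r ^ (n + 1) * (1 + lam * r ^ β) with hG
  have hFc : ContinuousOn F (Icc 0 1) := by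
    have h1 : ContinuousOn (fun r : ℝ => r ^ β) (Icc 0 1) :=
      (Real.continuous_rpow_const hβ0.le).continuousOn
    have h2 : ContinuousOn (fun r : ℝ => v r ^ (q + 1)) (Icc 0 1) :=
      hv.rpow_const (fun x _ => Or.inr (by linarith))
    simp only [hF]
    fun_prop
  have hF' : ∀ r ∈ Ioo (0 : ℝ) 1,
      HasDerivAt F (r ^ (n + 2) * G r * v r ^ (q + 1) / (q + 1)) r := by
    intro r hr
    have hr0 : r ≠ 0 := hr.1.ne'
    have d1 := (hasDerivAt_pow (n + 3) r)
    have d2 := (hasDerivAt_pow (2 * n + 4) r)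
    have d3 := (hasDerivAt_pow (n + 2) r)
    have d4 : HasDerivAt (fun r : ℝ => r ^ β) (β * r ^ (β - 1)) r :=
      Real.hasDerivAt_rpow_const (Or.inl hr0)
    have d5 := (hv' r hr).rpow_const (p := q + 1) (Or.inl (hpos r hr).ne')
    have d := ((((d1.sub d2).const_mul (1 / 2)).mul ((hW' r hr).pow 2)).add
      (((d3.const_mul (((n : ℝ) + 1) / 2)).mul (hv' r hr)).mul (hW' r hr))).add
      ((((d1.sub d2).mul ((d4.const_mul lam).const_add 1)).mul d5).div_const (q + 1))
    refine d.congr_deriv (Eq.symm ?_)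
    have e1 : v r ^ (q + 1) = v r ^ q * v r := Real.rpow_add_one (hpos r hr).ne' q
    have e2 : r ^ (β - 1) = r ^ β / r := by rw [Real.rpow_sub_one hr0]
    simp only [Pi.sub_apply, Pi.mul_apply, Pi.add_apply, Pi.pow_apply]
    rw [e2, add_sub_cancel_right, e1, hG]
    simp only []
    rw [hq1]
    generalize v r ^ q = A
    generalize r ^ β = R
    have x1 : n + 3 - 1 = n + 2 := by omega
    have x2 : 2 * n + 4 - 1 = 2 * n + 3 := by omega
    have x3 : n + 2 - 1 = n + 1 := by omega
    rw [x1, x2, x3]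
    push_cast
    have y1 : r ^ (2 * n + 3) = (r ^ n) ^ 2 * r ^ 3 := by ring
    have y2 : r ^ (2 * n + 4) = (r ^ n) ^ 2 * r ^ 4 := by ring
    rw [y1, y2]
    field_simp
    ring
  have hG0 : ∀ r ∈ Ioo (0 : ℝ) 1, G r ≤ 0 := by
    intro r hr
    have hρ : 0 < r ^ (n + 1) := pow_pos hr.1 _
    have hk := aux_key (n + 1) β lam (r ^ (n + 1)) (by linarith) hβ hl hlam hρ
    have e : r ^ β = (r ^ (n + 1)) ^ ((β - (n + 1 : ℝ)) / (n + 1 : ℝ)) * r ^ (n + 1) := by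
      rw [← Real.rpow_add_one hρ.ne', ← Real.rpow_natCast r (n + 1), ← Real.rpow_mul hr.1.le]
      congr 1
      push_cast
      field_simp
      ring
    simp only [hG]
    rw [e]
    generalize (r ^ (n + 1)) ^ ((β - (n + 1 : ℝ)) / (n + 1 : ℝ)) = Y at *
    generalize r ^ (n + 1) = ρ at *
    nlinarith [mul_le_mul_of_nonneg_left hk hρ.le]
  have hanti : AntitoneOn F (Icc 0 1) := by
    refine antitoneOn_of_deriv_nonpos (convex_Icc 0 1) hFc ?_ ?_
    · rw [interior_Icc]
      exact fun r hr => (hF' r hr).differentiableAt.differentiableWithinAt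
    · rw [interior_Icc]
      intro r hr
      rw [(hF' r hr).deriv]
      have h1 := hG0 r hr
      have h2 : 0 < v r ^ (q + 1) := Real.rpow_pos_of_pos (hpos r hr) _
      have h3 : 0 < r ^ (n + 2) := pow_pos hr.1 _
      apply div_nonpos_of_nonpos_of_nonneg _ (by linarith)
      exact mul_nonpos_of_nonpos_of_nonneg (mul_nonpos_of_nonneg_of_nonpos h3.le h1) h2.le
  have F0 : F 0 = 0 := by simp [hF]
  have F1 : F 1 = 0 := by simp [hF, hv1]
  have hFz : ∀ r ∈ Icc (0 : ℝ) 1, F r = 0 := by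
    intro r hr
    apply le_antisymm
    · rw [← F0]; exact hanti (by simp) hr hr.1
    · rw [← F1]; exact hanti hr (by simp) hr.2
  have hGz : ∀ r ∈ Ioo (0 : ℝ) 1, G r = 0 := by
    intro r hr
    have h0 : F =ᶠ[nhds r] fun _ => 0 := by
      filter_upwards [Ioo_mem_nhds hr.1 hr.2] with s hs using hFz s ⟨hs.1.le, hs.2.le⟩
    have h1 := ((hasDerivAt_const r (0 : ℝ)).congr_of_eventuallyEq h0).unique (hF' r hr)
    have h2 : 0 < v r ^ (q + 1) := Real.rpow_pos_of_pos (hpos r hr) _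
    have h3 : 0 < r ^ (n + 2) := pow_pos hr.1 _
    have h4 : q + 1 ≠ 0 := by linarith
    have h5 := h1.symm
    rw [div_eq_zero_iff] at h5
    simpa [h4, h2.ne', h3.ne', hr.1.ne'] using h5
  have hGc : Continuous G := by
    have h1 : Continuous (fun r : ℝ => r ^ β) := Real.continuous_rpow_const hβ0.le
    simp only [hG]
    fun_prop
  have hcl : (1 : ℝ) ∈ closure (Ioo (0 : ℝ) 1) := by
    rw [closure_Ioo (by norm_num)]; simp
  have hG1 : G 1 = 0 := by
    have hc : IsClosed {r | G r = 0} := isClosed_eq hGc continuous_const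
    exact (closure_minimal hGz hc) hcl
  simp only [hG] at hG1
  norm_num at hG1
  rcases hG1 with h | h <;> linarith

lemma aux_norm {N : ℕ} (i j : Fin N) (hij : j ≠ i) (r t : ℝ) :
    ‖r • EuclideanSpace.single i (1 : ℝ) + t • EuclideanSpace.single j (1 : ℝ)‖
      = √(r ^ 2 + t ^ 2) := by
  have h := norm_add_sq_real (r • EuclideanSpace.single i (1 : ℝ))
    (t • EuclideanSpace.single j (1 : ℝ))
  have ho : inner ℝ (EuclideanSpace.single i (1 : ℝ)) (EuclideanSpace.single j (1 : ℝ)) = 0 := by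
    rw [EuclideanSpace.inner_single_left]; simp [hij, hij.symm]
  rw [inner_smul_left, inner_smul_right, ho] at h
  simp [norm_smul] at h
  rw [← h, Real.sqrt_sq (norm_nonneg _)]

lemma aux_dir {N : ℕ} (u : EuclideanSpace ℝ (Fin N) → ℝ)
    (hr : ∀ x y : EuclideanSpace ℝ (Fin N), ‖x‖ = ‖y‖ → u x = u y)
    (h2 : ContDiffOn ℝ 2 u (ball 0 1)) (i j : Fin N) (hij : j ≠ i) (r : ℝ) (hr0 : 0 < r)
    (hr1 : r < 1) :
    fderiv ℝ (fun y => fderiv ℝ u y (EuclideanSpace.single j (1:ℝ)))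
      (r • EuclideanSpace.single i (1 : ℝ)) (EuclideanSpace.single j (1:ℝ)) =
    fderiv ℝ u (r • EuclideanSpace.single i (1 : ℝ)) (EuclideanSpace.single i (1:ℝ)) / r := by
  set e : EuclideanSpace ℝ (Fin N) := EuclideanSpace.single i (1:ℝ) with he
  set f : EuclideanSpace ℝ (Fin N) := EuclideanSpace.single j (1:ℝ) with hf
  have hne : ‖e‖ = 1 := by simp [he]
  have hmem : ∀ s : ℝ, 0 ≤ s → s < 1 → s • e ∈ ball (0 : EuclideanSpace ℝ (Fin N)) 1 := by
    intro s h0 h1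
    simp [norm_smul, hne, abs_of_nonneg h0, h1]
  have hfd : ContDiffOn ℝ 1 (fderiv ℝ u) (ball 0 1) :=
    h2.fderiv_of_isOpen isOpen_ball (by norm_num)
  have hud : ∀ x ∈ ball (0 : EuclideanSpace ℝ (Fin N)) 1, DifferentiableAt ℝ u x := fun x hx =>
    (h2.differentiableOn (by norm_num)).differentiableAt (isOpen_ball.mem_nhds hx)
  have hdd : DifferentiableAt ℝ (fderiv ℝ u) (r • e) :=
    (hfd.differentiableOn (by norm_num)).differentiableAt (isOpen_ball.mem_nhds (hmem r hr0.le hr1))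
  have hdd' : DifferentiableAt ℝ (fun y => fderiv ℝ u y f) (r • e) := hdd.clm_apply (by fun_prop)
  have hline : HasDerivAt (fun t : ℝ => r • e + t • f) f 0 := by
    simpa using ((hasDerivAt_id (0:ℝ)).smul_const f).const_add (r • e)
  have hA : HasDerivAt (fun t : ℝ => fderiv ℝ u (r • e + t • f) f)
      (fderiv ℝ (fun y => fderiv ℝ u y f) (r • e) f) 0 := by
    have hx : HasFDerivAt (fun y => fderiv ℝ u y f) (fderiv ℝ (fun y => fderiv ℝ u y f) (r • e))
      (r • e + (0:ℝ) • f) := by simpa using hdd'.hasFDerivAt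
    exact hx.comp_hasDerivAt 0 hline
  set h : ℝ → ℝ := fun t => fderiv ℝ u (√(r ^ 2 + t ^ 2) • e) e / √(r ^ 2 + t ^ 2) with hh
  have hs0 : √(r ^ 2 + (0:ℝ) ^ 2) = r := by simp [Real.sqrt_sq hr0.le]
  have hh0 : h 0 = fderiv ℝ u (r • e) e / r := by simp only [hh, hs0]
  have hsc : Continuous (fun t : ℝ => √(r ^ 2 + t ^ 2)) := by fun_prop
  have hhc : ContinuousAt h 0 := by
    have c1 : ContinuousAt (fun t : ℝ => √(r ^ 2 + t ^ 2) • e) 0 := by fun_prop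
    have c2 : ContinuousAt (fderiv ℝ u) (√(r ^ 2 + (0:ℝ) ^ 2) • e) := by
      rw [hs0]; exact hdd.continuousAt
    have c3 : ContinuousAt (fun t : ℝ => fderiv ℝ u (√(r ^ 2 + t ^ 2) • e)) 0 :=
      ContinuousAt.comp (f := fun t : ℝ => √(r ^ 2 + t ^ 2) • e) c2 c1
    exact (c3.clm_apply continuousAt_const).div hsc.continuousAt (by rw [hs0]; exact hr0.ne')
  have hev : (fun t : ℝ => fderiv ℝ u (r • e + t • f) f) =ᶠ[nhds 0] fun t => t * h t := by
    have : ∀ᶠ t in nhds (0:ℝ), √(r ^ 2 + t ^ 2) < 1 :=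
      hsc.continuousAt.eventually_lt continuousAt_const (by rw [hs0]; exact hr1)
    filter_upwards [this] with t ht
    have hp : 0 < r ^ 2 + t ^ 2 := by positivity
    have hsp : 0 < √(r ^ 2 + t ^ 2) := Real.sqrt_pos.2 hp
    have hm : r • e + t • f ∈ ball (0 : EuclideanSpace ℝ (Fin N)) 1 := by
      rw [mem_ball_zero_iff, aux_norm i j hij]; exact ht
    have l1 : HasDerivAt (fun t : ℝ => r • e + t • f) f t := by
      simpa using ((hasDerivAt_id t).smul_const f).const_add (r • e)
    have g1 : HasDerivAt (fun t : ℝ => u (r • e + t • f)) (fderiv ℝ u (r • e + t • f) f) t :=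
      (hud _ hm).hasFDerivAt.comp_hasDerivAt t l1
    have eq : (fun t : ℝ => u (r • e + t • f)) = fun t => u (√(r ^ 2 + t ^ 2) • e) := by
      funext s
      apply hr
      rw [aux_norm i j hij, norm_smul, hne, Real.norm_of_nonneg (Real.sqrt_nonneg _), mul_one]
    rw [eq] at g1
    have l2 : HasDerivAt (fun t : ℝ => √(r ^ 2 + t ^ 2)) (t / √(r ^ 2 + t ^ 2)) t := by
      have := ((hasDerivAt_pow 2 t).const_add (r ^ 2)).sqrt hp.ne'
      convert this using 1
      field_simp
      simp [mul_comm]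
    have g2 : HasDerivAt (fun t : ℝ => u (√(r ^ 2 + t ^ 2) • e))
        (fderiv ℝ u (√(r ^ 2 + t ^ 2) • e) ((t / √(r ^ 2 + t ^ 2)) • e)) t :=
      (hud _ (hmem _ hsp.le ht)).hasFDerivAt.comp_hasDerivAt t (l2.smul_const e)
    rw [g1.unique g2]
    simp only [hh, map_smul, smul_eq_mul]
    ring
  have hB : HasDerivAt (fun t => t * h t) (h 0) 0 := by
    rw [hasDerivAt_iff_tendsto_slope]
    refine (hhc.tendsto.mono_left nhdsWithin_le_nhds).congr' ?_
    filter_upwards [self_mem_nhdsWithin] with t ht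
    have : t ≠ 0 := ht
    simp [slope, this]
  rw [← hh0]
  exact (hA.congr_of_eventuallyEq hev.symm).unique hB

theorem stmt_10 (N : ℕ) (hN : 3 ≤ N) (β lam : ℝ) (hβ : (N : ℝ) - 2 < β)
    (hlam : lam ∈ Icc 0 (2 * ((N : ℝ) - 1) / ((N : ℝ) - 2) *
      ((2 * (N : ℝ) - 2 + β) / (β - (N : ℝ) + 2)) ^ ((β - (N : ℝ) + 2) / ((N : ℝ) - 2)))) :
    ¬ ∃ u : EuclideanSpace ℝ (Fin N) → ℝ,
      (∀ x y : EuclideanSpace ℝ (Fin N), ‖x‖ = ‖y‖ → u x = u y) ∧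
      ContDiffOn ℝ 1 u (closedBall 0 1) ∧
      ContDiffOn ℝ 2 u (ball 0 1) ∧
      (∀ x ∈ ball (0 : EuclideanSpace ℝ (Fin N)) 1, 0 < u x) ∧
      (∀ x ∈ sphere (0 : EuclideanSpace ℝ (Fin N)) 1, u x = 0) ∧
      (∀ x ∈ ball (0 : EuclideanSpace ℝ (Fin N)) 1,
        -laplacian u x = (1 + lam * ‖x‖ ^ β) * u x ^ (((N : ℝ) + 2) / ((N : ℝ) - 2))) := by
  rintro ⟨u, hrad, hc1, hc2, hpos, hzero, heq⟩
  obtain ⟨n, rfl⟩ : ∃ n, N = n + 3 := ⟨N - 3, by omega⟩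
  have z1 : ((n + 3 : ℕ) : ℝ) - 2 = n + 1 := by push_cast; ring
  have z2 : ((n + 3 : ℕ) : ℝ) - 1 = (n + 1 : ℝ) + 1 := by push_cast; ring
  have z3 : 2 * ((n + 3 : ℕ) : ℝ) - 2 + β = 2 * (n + 1 : ℝ) + 2 + β := by push_cast; ring
  have z4 : β - ((n + 3 : ℕ) : ℝ) + 2 = β - (n + 1 : ℝ) := by push_cast; ring
  have z5 : ((n + 3 : ℕ) : ℝ) + 2 = n + 5 := by push_cast; ring
  rw [z1, z2, z3, z4] at hlam
  rw [z1] at hβ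
  rw [z1, z5] at heq
  set e : EuclideanSpace ℝ (Fin (n + 3)) := EuclideanSpace.single 0 (1:ℝ) with he
  have hne : ‖e‖ = 1 := by simp [he]
  have hnr : ∀ r : ℝ, 0 ≤ r → ‖r • e‖ = r := by
    intro r h0
    rw [norm_smul, hne, Real.norm_of_nonneg h0, mul_one]
  have hmc : MapsTo (fun r : ℝ => r • e) (Icc 0 1) (closedBall 0 1) := by
    intro r h
    rw [mem_closedBall_zero_iff, hnr r h.1]; exact h.2
  have hmo : ∀ r ∈ Ioo (0:ℝ) 1, r • e ∈ ball (0 : EuclideanSpace ℝ (Fin (n + 3))) 1 := by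
    intro r h
    rw [mem_ball_zero_iff, hnr r h.1.le]; exact h.2
  have hlc : ContinuousOn (fun r : ℝ => r • e) (Icc 0 1) := by fun_prop
  have huniq : UniqueDiffOn ℝ (closedBall (0 : EuclideanSpace ℝ (Fin (n + 3))) 1) :=
    uniqueDiffOn_convex (convex_closedBall _ _)
      (by rw [interior_closedBall _ one_ne_zero]; exact ⟨0, by simp⟩)
  have hWeq : ∀ r ∈ Ioo (0:ℝ) 1, fderivWithin ℝ u (closedBall 0 1) (r • e) = fderiv ℝ u (r • e) := by
    intro r h
    exact fderivWithin_of_mem_nhds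
      (mem_of_superset (isOpen_ball.mem_nhds (hmo r h)) ball_subset_closedBall)
  have hlin : ∀ r : ℝ, HasDerivAt (fun r : ℝ => r • e) e r := by
    intro r
    simpa using (hasDerivAt_id r).smul_const e
  refine aux_ode n β lam hβ hlam.1 hlam.2 (fun r => u (r • e))
    (fun r => fderivWithin ℝ u (closedBall 0 1) (r • e) e) ?_ ?_ ?_ ?_ ?_ ?_
  · exact hc1.continuousOn.comp hlc hmc
  · have := (hc1.continuousOn_fderivWithin huniq (by norm_num)).comp hlc hmc
    exact this.clm_apply continuousOn_const
  · intro r h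
    simp only [hWeq r h]
    have hd : DifferentiableAt ℝ u (r • e) :=
      (hc2.differentiableOn (by norm_num)).differentiableAt (isOpen_ball.mem_nhds (hmo r h))
    exact hd.hasFDerivAt.comp_hasDerivAt r (hlin r)
  · intro r h
    have hfd : ContDiffOn ℝ 1 (fderiv ℝ u) (ball 0 1) :=
      hc2.fderiv_of_isOpen isOpen_ball (by norm_num)
    have hdd : DifferentiableAt ℝ (fderiv ℝ u) (r • e) :=
      (hfd.differentiableOn (by norm_num)).differentiableAt (isOpen_ball.mem_nhds (hmo r h))
    have hdd' : DifferentiableAt ℝ (fun y => fderiv ℝ u y e) (r • e) := hdd.clm_apply (by fun_prop)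
    have hA : HasDerivAt (fun t : ℝ => fderiv ℝ u (t • e) e)
        (fderiv ℝ (fun y => fderiv ℝ u y e) (r • e) e) r :=
      HasFDerivAt.comp_hasDerivAt (l := fun y => fderiv ℝ u y e) r hdd'.hasFDerivAt (hlin r)
    have hev : (fun r : ℝ => fderivWithin ℝ u (closedBall 0 1) (r • e) e) =ᶠ[nhds r]
        fun t : ℝ => fderiv ℝ u (t • e) e := by
      filter_upwards [Ioo_mem_nhds h.1 h.2] with s hs
      rw [hWeq s hs]
    have hB := hA.congr_of_eventuallyEq hev
    refine hB.congr_deriv (Eq.symm ?_)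
    have hE := heq _ (hmo r h)
    rw [hnr r h.1.le] at hE
    rw [← hE, hWeq r h, laplacian, Fin.sum_univ_succ]
    have : ∀ i : Fin (n + 2), fderiv ℝ (fun y => fderiv ℝ u y (EuclideanSpace.single i.succ (1:ℝ)))
      (r • e) (EuclideanSpace.single i.succ (1:ℝ)) = fderiv ℝ u (r • e) e / r := fun i =>
      aux_dir u hrad hc2 0 i.succ (Fin.succ_ne_zero i) r h.1 h.2
    rw [Finset.sum_congr rfl (fun i _ => this i)]
    simp only [Finset.sum_const, Finset.card_univ, Fintype.card_fin, nsmul_eq_mul]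
    push_cast
    rw [← he]
    ring
  · intro r h
    exact hpos _ (hmo r h)
  · apply hzero
    simp [hne]
end

section
/- Let N ≥ 3 be an integer, q ≥ 1 a real number, g : [0,1] → ℝ continuously differentiable, and ψ : [0,1] → ℝ three times continuously differentiable with ψ(0) = 0. Let u : [0,1] → ℝ be twice continuously differentiable with u'(0) = 0 and u(1) = 0, satisfying the ODE −u''(r) − ((N−1)/r)·u'(r) = |u(r)|^(4/(N−2))·u(r) + g(r)·|u(r)|^(q−1)·u(r) for all r ∈ (0,1). Then ψ(1)·|u'(1)|² = (1/2)·∫₀¹ u(r)²·r^(N−4)·( r³·ψ'''(r) − (N−1)(N−3)·r·ψ'(r) + (N−1)(N−3)·ψ(r) ) dr + (2(N−1)/N)·∫₀¹ |u(r)|^(2N/(N−2))·( r^(N−1)·ψ'(r) − r^(N−2)·ψ(r) ) dr + (1/(q+1))·∫₀¹ |u(r)|^(q+1)·( (q+3)·g(r)·r^(N−1)·ψ'(r) − (q−1)(N−1)·g(r)·r^(N−2)·ψ(r) + 2·g'(r)·r^(N−1)·ψ(r) ) dr. -/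
open MeasureTheory Filter Set

theorem aux_pow (s : ℝ) (hs : 2 ≤ s) (u : ℝ → ℝ) (v r : ℝ) (h : HasDerivAt u v r) :
    HasDerivAt (fun r => 2 / s * |u r| ^ s) (2 * (|u r| ^ (s - 2) * u r) * v) r := by
  have h1 := ((hasDerivAt_abs_rpow (u r) (by linarith : 1 < s)).comp r h).const_mul (2 / s)
  refine h1.congr_deriv ?_
  have : s ≠ 0 := by linarith
  field_simp

theorem aux_sq (s : ℝ) (hs : 2 ≤ s) (x : ℝ) : |x| ^ s = |x| ^ (s - 2) * x * x := by
  have h : |x| ^ (s - 2 + 2) = |x| ^ (s - 2) * |x| ^ (2:ℝ) :=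
    Real.rpow_add_of_nonneg (abs_nonneg x) (by linarith) (by norm_num)
  rw [sub_add_cancel] at h
  rw [h, Real.rpow_two, sq_abs]; ring

theorem stmt_11 (N : ℕ) (hN : 3 ≤ N) (q : ℝ) (hq : 1 ≤ q)
    (g g' ψ ψ' ψ'' ψ''' u u' u'' : ℝ → ℝ)
    (hg : ∀ r ∈ Icc (0:ℝ) 1, HasDerivWithinAt g (g' r) (Icc 0 1) r)
    (hg' : ContinuousOn g' (Icc 0 1))
    (hψ : ∀ r ∈ Icc (0:ℝ) 1, HasDerivWithinAt ψ (ψ' r) (Icc 0 1) r)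
    (hψ' : ∀ r ∈ Icc (0:ℝ) 1, HasDerivWithinAt ψ' (ψ'' r) (Icc 0 1) r)
    (hψ'' : ∀ r ∈ Icc (0:ℝ) 1, HasDerivWithinAt ψ'' (ψ''' r) (Icc 0 1) r)
    (hψ''' : ContinuousOn ψ''' (Icc 0 1))
    (hψ0 : ψ 0 = 0)
    (hu : ∀ r ∈ Icc (0:ℝ) 1, HasDerivWithinAt u (u' r) (Icc 0 1) r)
    (hu' : ∀ r ∈ Icc (0:ℝ) 1, HasDerivWithinAt u' (u'' r) (Icc 0 1) r)
    (hu'' : ContinuousOn u'' (Icc 0 1))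
    (hu'0 : u' 0 = 0) (hu1 : u 1 = 0)
    (hode : ∀ r ∈ Ioo (0:ℝ) 1,
      -u'' r - ((N : ℝ) - 1) / r * u' r
        = |u r| ^ ((4:ℝ) / ((N : ℝ) - 2)) * u r + g r * |u r| ^ (q - 1) * u r) :
    ψ 1 * (u' 1) ^ 2
      = (1/2) * (∫ r in (0:ℝ)..1, (u r) ^ 2 * r ^ ((N : ℝ) - 4) *
            (r ^ (3:ℕ) * ψ''' r - ((N : ℝ) - 1) * ((N : ℝ) - 3) * r * ψ' r
              + ((N : ℝ) - 1) * ((N : ℝ) - 3) * ψ r))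
        + (2 * ((N : ℝ) - 1) / (N : ℝ)) * (∫ r in (0:ℝ)..1,
            |u r| ^ (2 * (N : ℝ) / ((N : ℝ) - 2)) *
              (r ^ ((N : ℝ) - 1) * ψ' r - r ^ ((N : ℝ) - 2) * ψ r))
        + (1 / (q + 1)) * (∫ r in (0:ℝ)..1, |u r| ^ (q + 1) *
            ((q + 3) * g r * r ^ ((N : ℝ) - 1) * ψ' r
              - (q - 1) * ((N : ℝ) - 1) * g r * r ^ ((N : ℝ) - 2) * ψ r
              + 2 * g' r * r ^ ((N : ℝ) - 1) * ψ r)) := by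
  obtain ⟨m, rfl⟩ : ∃ m, N = m + 3 := ⟨N - 3, by omega⟩
  have hm0 : (0:ℝ) ≤ m := Nat.cast_nonneg m
  have hm1 : (m:ℝ) + 1 ≠ 0 := by positivity
  have hm3 : (m:ℝ) + 3 ≠ 0 := by positivity
  have hq1 : q + 1 ≠ 0 := by linarith
  push_cast at hode ⊢
  obtain ⟨s, hs⟩ : ∃ s : ℝ, s = 2 * ((m:ℝ) + 3) / ((m:ℝ) + 3 - 2) := ⟨_, rfl⟩
  have hm1' : (m:ℝ) + 3 - 2 ≠ 0 := by intro h; apply hm1; linarith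
  have hs4 : (4:ℝ) / ((m:ℝ) + 3 - 2) = s - 2 := by
    rw [hs]; field_simp; ring
  have hs2 : 2 ≤ s := by
    have : 0 ≤ (4:ℝ) / ((m:ℝ) + 3 - 2) := by
      apply div_nonneg (by norm_num); linarith
    linarith
  have hs0 : s ≠ 0 := by linarith
  have hss : 2 / s = ((m:ℝ) + 1) / (m + 3) := by
    rw [hs]; field_simp; ring
  rw [← hs]
  rw [hs4] at hode
  have hqq : q - 1 = (q + 1) - 2 := by ring
  have cg : ContinuousOn g (Icc 0 1) := fun r hr => (hg r hr).continuousWithinAt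
  have cψ : ContinuousOn ψ (Icc 0 1) := fun r hr => (hψ r hr).continuousWithinAt
  have cψ' : ContinuousOn ψ' (Icc 0 1) := fun r hr => (hψ' r hr).continuousWithinAt
  have cψ'' : ContinuousOn ψ'' (Icc 0 1) := fun r hr => (hψ'' r hr).continuousWithinAt
  have cu : ContinuousOn u (Icc 0 1) := fun r hr => (hu r hr).continuousWithinAt
  have cu' : ContinuousOn u' (Icc 0 1) := fun r hr => (hu' r hr).continuousWithinAt
  have cP : ContinuousOn (fun r => |u r| ^ s) (Icc 0 1) :=
    cu.abs.rpow_const (fun _ _ => Or.inr (by linarith))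
  have cQ : ContinuousOn (fun r => |u r| ^ (q + 1)) (Icc 0 1) :=
    cu.abs.rpow_const (fun _ _ => Or.inr (by linarith))
  obtain ⟨A, hA⟩ : ∃ A : ℝ → ℝ, A = fun r => u r ^ 2 * (r ^ (m + 2) * ψ''' r
    - ((m:ℝ) + 2) * m * r ^ m * ψ' r + ((m:ℝ) + 2) * (m * r ^ (m - 1)) * ψ r) := ⟨_, rfl⟩
  obtain ⟨B, hB⟩ : ∃ B : ℝ → ℝ, B = fun r => |u r| ^ s *
    (r ^ (m + 2) * ψ' r - r ^ (m + 1) * ψ r) := ⟨_, rfl⟩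
  obtain ⟨C, hC⟩ : ∃ C : ℝ → ℝ, C = fun r => |u r| ^ (q + 1) *
    ((q + 3) * g r * r ^ (m + 2) * ψ' r - (q - 1) * ((m:ℝ) + 2) * g r * r ^ (m + 1) * ψ r
      + 2 * g' r * r ^ (m + 2) * ψ r) := ⟨_, rfl⟩
  have cA : ContinuousOn A (Icc 0 1) := by rw [hA]; fun_prop
  have cB : ContinuousOn B (Icc 0 1) := by rw [hB]; fun_prop
  have cC : ContinuousOn C (Icc 0 1) := by rw [hC]; fun_prop
  have e2 : ∀ r : ℝ, r ^ ((m:ℝ) + 3 - 1) = r ^ (m + 2) := fun r => by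
    rw [← Real.rpow_natCast]; congr 1; push_cast; ring
  have e1 : ∀ r : ℝ, r ^ ((m:ℝ) + 3 - 2) = r ^ (m + 1) := fun r => by
    rw [← Real.rpow_natCast]; congr 1; push_cast; ring
  have iA : (∫ r in (0:ℝ)..1, (u r) ^ 2 * r ^ ((m : ℝ) + 3 - 4) *
            (r ^ (3:ℕ) * ψ''' r - ((m : ℝ) + 3 - 1) * ((m : ℝ) + 3 - 3) * r * ψ' r
              + ((m : ℝ) + 3 - 1) * ((m : ℝ) + 3 - 3) * ψ r)) = ∫ r in (0:ℝ)..1, A r := by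
    apply intervalIntegral.integral_congr_ae
    refine ae_of_all _ fun r hr => ?_
    rw [uIoc_of_le zero_le_one] at hr
    have hr0 : 0 < r := hr.1
    have e0 : r ^ ((m:ℝ) + 3 - 4) * r = r ^ m := by
      rw [← Real.rpow_natCast r m, ← Real.rpow_add_one hr0.ne']; congr 1; ring
    have e0' : (m:ℝ) * r ^ ((m:ℝ) + 3 - 4) = m * r ^ (m - 1) := by
      rcases m with _ | j
      · simp
      · congr 1
        rw [← Real.rpow_natCast]; congr 1; push_cast [Nat.add_sub_cancel]; ring
    rw [hA]
    simp only
    linear_combination (u r ^ 2 * (r ^ 2 * ψ''' r - ((m:ℝ) + 2) * m * ψ' r)) * e0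
      + (u r ^ 2 * ((m:ℝ) + 2) * ψ r) * e0'
  have iB : (∫ r in (0:ℝ)..1, |u r| ^ s *
      (r ^ ((m : ℝ) + 3 - 1) * ψ' r - r ^ ((m : ℝ) + 3 - 2) * ψ r)) = ∫ r in (0:ℝ)..1, B r := by
    simp only [e1, e2, hB]
  have iC : (∫ r in (0:ℝ)..1, |u r| ^ (q + 1) *
            ((q + 3) * g r * r ^ ((m : ℝ) + 3 - 1) * ψ' r
              - (q - 1) * ((m : ℝ) + 3 - 1) * g r * r ^ ((m : ℝ) + 3 - 2) * ψ r
              + 2 * g' r * r ^ ((m : ℝ) + 3 - 1) * ψ r)) = ∫ r in (0:ℝ)..1, C r := by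
    have : (m:ℝ) + 3 - 1 = m + 2 := by ring
    simp only [e1, e2, hC]
    simp only [this]
  rw [iA, iB, iC]
  have hu01 : uIcc (0:ℝ) 1 = Icc 0 1 := uIcc_of_le zero_le_one
  have nA : IntervalIntegrable A volume 0 1 := ContinuousOn.intervalIntegrable (by rwa [hu01])
  have nB : IntervalIntegrable B volume 0 1 := ContinuousOn.intervalIntegrable (by rwa [hu01])
  have nC : IntervalIntegrable C volume 0 1 := ContinuousOn.intervalIntegrable (by rwa [hu01])
  obtain ⟨F, hF⟩ : ∃ F : ℝ → ℝ, F = fun r => r ^ (m + 2) * ψ r * (u' r) ^ 2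
      - (r ^ (m + 2) * ψ' r - ((m:ℝ) + 2) * (r ^ (m + 1) * ψ r)) * (u r * u' r)
      + 1 / 2 * ((r ^ (m + 2) * ψ'' r - ((m:ℝ) + 2) * (r ^ (m + 1) * ψ' r)
          + ((m:ℝ) + 2) * (r ^ m * ψ r)) * (u r) ^ 2)
      + r ^ (m + 2) * ψ r * (2 / s * |u r| ^ s + g r * (2 / (q + 1) * |u r| ^ (q + 1))) := ⟨_, rfl⟩
  have cF : ContinuousOn F (Icc 0 1) := by rw [hF]; fun_prop
  have key := intervalIntegral.integral_eq_sub_of_hasDerivAt_of_le (f := F)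
    (f' := fun r => 1 / 2 * A r + 2 * ((m:ℝ) + 2) / (m + 3) * B r + 1 / (q + 1) * C r)
    zero_le_one cF ?_ (((nA.const_mul _).add (nB.const_mul _)).add (nC.const_mul _))
  · rw [intervalIntegral.integral_add ((nA.const_mul _).add (nB.const_mul _)) (nC.const_mul _),
      intervalIntegral.integral_add (nA.const_mul _) (nB.const_mul _),
      intervalIntegral.integral_const_mul, intervalIntegral.integral_const_mul,
      intervalIntegral.integral_const_mul] at key
    have F0 : F 0 = 0 := by rw [hF]; simp [hψ0]
    have F1 : F 1 = ψ 1 * u' 1 ^ 2 := by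
      rw [hF]; simp [hu1, Real.zero_rpow hs0, Real.zero_rpow hq1]
    rw [F0, F1] at key
    rw [show (m:ℝ) + 3 - 1 = m + 2 by ring]
    linarith
  · intro r hr
    have hrI : r ∈ Icc (0:ℝ) 1 := Ioo_subset_Icc_self hr
    have nb : Icc (0:ℝ) 1 ∈ nhds r := Icc_mem_nhds hr.1 hr.2
    have hr0 : r ≠ 0 := hr.1.ne'
    have dg := (hg r hrI).hasDerivAt nb
    have d0 := (hψ r hrI).hasDerivAt nb
    have d1 := (hψ' r hrI).hasDerivAt nb
    have d2 := (hψ'' r hrI).hasDerivAt nb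
    have du := (hu r hrI).hasDerivAt nb
    have du' := (hu' r hrI).hasDerivAt nb
    have p2 := hasDerivAt_pow (m + 2) r
    have p1 := hasDerivAt_pow (m + 1) r
    have p0 := hasDerivAt_pow m r
    have dP := aux_pow s hs2 u _ r du
    have dQ := aux_pow (q + 1) (by linarith) u _ r du
    have ode := hode r hr
    rw [hqq] at ode
    have ode' : r * u'' r = - ((m:ℝ) + 2) * u' r - r * (|u r| ^ (s - 2) * u r
        + g r * |u r| ^ (q + 1 - 2) * u r) := by
      rw [← ode]; field_simp; ring
    have sP := aux_sq s hs2 (u r)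
    have sQ := aux_sq (q + 1) (by linarith) (u r)
    have D := ((((p2.mul d0).mul (du'.pow 2)).sub
      (((p2.mul d1).sub ((p1.mul d0).const_mul ((m:ℝ) + 2))).mul (du.mul du'))).add
      (((((p2.mul d2).sub ((p1.mul d1).const_mul ((m:ℝ) + 2))).add
        ((p0.mul d0).const_mul ((m:ℝ) + 2))).mul (du.pow 2)).const_mul (1 / 2))).add
      ((p2.mul d0).mul (dP.add (dg.mul dQ)))
    rw [hF]
    refine HasDerivAt.congr_deriv D ?_
    simp only [hA, hB, hC, hss, Pi.mul_apply, Pi.pow_apply, Pi.add_apply, Pi.sub_apply]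
    simp only [sP, sQ]
    generalize |u r| ^ (s - 2) = a at *
    generalize |u r| ^ (q + 1 - 2) = b at *
    push_cast
    try simp only [Nat.add_sub_cancel, show m + 2 - 1 = m + 1 by omega]
    generalize r ^ (m - 1) = X
    simp only [pow_succ]
    generalize r ^ m = Y
    have i3 : ((m:ℝ) + 3)⁻¹ * ((m:ℝ) + 3) = 1 := inv_mul_cancel₀ hm3
    have iq : (q + 1)⁻¹ * (q + 1) = 1 := inv_mul_cancel₀ hq1
    have hz : ∀ z, z = r * u'' r → z = r * u'' r := fun _ h => h
    rw [← sub_eq_zero]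
    field_simp
    linear_combination (2 * (m+3) * (q+1) * (2 * Y * r * ψ r * u' r - (Y * r * ψ' r - (m+2) * Y * ψ r) * u r)) * ode'
end

section
/- Let N ≥ 3 be an integer, q ≥ 1 a real number, g : [0,1] → ℝ continuously differentiable, and ψ : [0,1] → ℝ continuously differentiable with ψ(0) = 0. Let u : [0,1] → ℝ be twice continuously differentiable with u'(0) = 0 and u(1) = 0, satisfying −u''(r) − ((N−1)/r)·u'(r) = |u(r)|^(4/(N−2))·u(r) + g(r)·|u(r)|^(q−1)·u(r) for all r ∈ (0,1). Then (multiplying the equation by r^(N−1)·ψ·u' and integrating) one has: ψ(1)·|u'(1)|² − ∫₀¹ |u'(r)|²·( r^(N−1)·ψ'(r) − (N−1)·r^(N−2)·ψ(r) ) dr = ((N−2)/N)·∫₀¹ |u(r)|^(2N/(N−2))·( r^(N−1)·ψ'(r) + (N−1)·r^(N−2)·ψ(r) ) dr + (2/(q+1))·∫₀¹ |u(r)|^(q+1)·( g'(r)·r^(N−1)·ψ(r) + g(r)·r^(N−1)·ψ'(r) + (N−1)·g(r)·r^(N−2)·ψ(r) ) dr. -/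
open MeasureTheory Filter Set

theorem stmt_12 (N : ℕ) (hN : 3 ≤ N) (q : ℝ) (hq : 1 ≤ q)
    (g g' ψ ψ' u u' u'' : ℝ → ℝ)
    (hg : ∀ r ∈ Icc (0:ℝ) 1, HasDerivWithinAt g (g' r) (Icc 0 1) r)
    (hg' : ContinuousOn g' (Icc 0 1))
    (hψ : ∀ r ∈ Icc (0:ℝ) 1, HasDerivWithinAt ψ (ψ' r) (Icc 0 1) r)
    (hψ' : ContinuousOn ψ' (Icc 0 1))
    (hψ0 : ψ 0 = 0)
    (hu : ∀ r ∈ Icc (0:ℝ) 1, HasDerivWithinAt u (u' r) (Icc 0 1) r)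
    (hu' : ∀ r ∈ Icc (0:ℝ) 1, HasDerivWithinAt u' (u'' r) (Icc 0 1) r)
    (hu'' : ContinuousOn u'' (Icc 0 1))
    (hu'0 : u' 0 = 0) (hu1 : u 1 = 0)
    (hode : ∀ r ∈ Ioo (0:ℝ) 1,
      -u'' r - ((N : ℝ) - 1) / r * u' r
        = |u r| ^ ((4:ℝ) / ((N : ℝ) - 2)) * u r + g r * |u r| ^ (q - 1) * u r) :
    ψ 1 * (u' 1) ^ 2
      - (∫ r in (0:ℝ)..1, (u' r) ^ 2 *
          (r ^ ((N : ℝ) - 1) * ψ' r - ((N : ℝ) - 1) * r ^ ((N : ℝ) - 2) * ψ r))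
      = (((N : ℝ) - 2) / (N : ℝ)) * (∫ r in (0:ℝ)..1,
            |u r| ^ (2 * (N : ℝ) / ((N : ℝ) - 2)) *
              (r ^ ((N : ℝ) - 1) * ψ' r + ((N : ℝ) - 1) * r ^ ((N : ℝ) - 2) * ψ r))
        + (2 / (q + 1)) * (∫ r in (0:ℝ)..1, |u r| ^ (q + 1) *
            (g' r * r ^ ((N : ℝ) - 1) * ψ r + g r * r ^ ((N : ℝ) - 1) * ψ' r
              + ((N : ℝ) - 1) * g r * r ^ ((N : ℝ) - 2) * ψ r)) := by
  obtain ⟨n, rfl⟩ := Nat.exists_eq_add_of_le' hN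
  have e1 : ∀ r : ℝ, r ^ (((n + 3 : ℕ) : ℝ) - 1) = r ^ (n + 2) := fun r => by
    rw [← Real.rpow_natCast]; congr 1; push_cast; ring
  have e2 : ∀ r : ℝ, r ^ (((n + 3 : ℕ) : ℝ) - 2) = r ^ (n + 1) := fun r => by
    rw [← Real.rpow_natCast]; congr 1; push_cast; ring
  simp only [e1, e2]
  have hn0 : (0:ℝ) ≤ n := n.cast_nonneg
  set M : ℝ := ((n + 3 : ℕ) : ℝ) with hM
  have hM3 : M = n + 3 := by rw [hM]; push_cast; ring
  set p : ℝ := 2 * M / (M - 2) with hp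
  have hM2 : 0 < M - 2 := by linarith
  have hp2 : p - 2 = 4 / (M - 2) := by rw [hp]; field_simp; ring
  have hp1 : 2 < p := by
    have : 0 < 4 / (M - 2) := by positivity
    linarith
  have hMp : (M - 2) / M = 2 / p := by
    have : 0 < M := by linarith
    rw [hp]; field_simp
  have cg : ContinuousOn g (Icc 0 1) := fun r hr => (hg r hr).continuousWithinAt
  have cψ : ContinuousOn ψ (Icc 0 1) := fun r hr => (hψ r hr).continuousWithinAt
  have cu : ContinuousOn u (Icc 0 1) := fun r hr => (hu r hr).continuousWithinAt
  have cu' : ContinuousOn u' (Icc 0 1) := fun r hr => (hu' r hr).continuousWithinAt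
  have cP : ContinuousOn (fun r => |u r| ^ p) (Icc 0 1) :=
    cu.abs.rpow_const (fun _ _ => Or.inr (by linarith))
  have cQ : ContinuousOn (fun r => |u r| ^ (q + 1)) (Icc 0 1) :=
    cu.abs.rpow_const (fun _ _ => Or.inr (by linarith))
  have c1 : ContinuousOn (fun r => (u' r) ^ 2 *
          (r ^ (n + 2) * ψ' r - (M - 1) * r ^ (n + 1) * ψ r)) (Icc 0 1) := by fun_prop
  have c2 : ContinuousOn (fun r => |u r| ^ p *
          (r ^ (n + 2) * ψ' r + (M - 1) * r ^ (n + 1) * ψ r)) (Icc 0 1) :=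
    cP.mul (by fun_prop)
  have c3 : ContinuousOn (fun r => |u r| ^ (q + 1) *
            (g' r * r ^ (n + 2) * ψ r + g r * r ^ (n + 2) * ψ' r
              + (M - 1) * g r * r ^ (n + 1) * ψ r)) (Icc 0 1) :=
    cQ.mul (by fun_prop)
  have h01 : (0:ℝ) ≤ 1 := zero_le_one
  have i1 := c1.intervalIntegrable_of_Icc (μ := volume) h01
  have i2 := (c2.intervalIntegrable_of_Icc (μ := volume) h01).const_mul (2 / p)
  have i3 := (c3.intervalIntegrable_of_Icc (μ := volume) h01).const_mul (2 / (q + 1))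
  have cF : ContinuousOn (fun r => r ^ (n + 2) * ψ r * ((u' r) ^ 2 + 2 / p * |u r| ^ p
      + 2 / (q + 1) * (g r * |u r| ^ (q + 1)))) (Icc 0 1) := by
    refine ContinuousOn.mul (by fun_prop) ?_
    exact ((cu'.pow 2).add (continuousOn_const.mul cP)).add (continuousOn_const.mul (cg.mul cQ))
  have key := intervalIntegral.integral_eq_sub_of_hasDerivAt_of_le h01 cF
    (f' := fun r => (u' r) ^ 2 *
          (r ^ (n + 2) * ψ' r - (M - 1) * r ^ (n + 1) * ψ r) + 2 / p * (|u r| ^ p *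
          (r ^ (n + 2) * ψ' r + (M - 1) * r ^ (n + 1) * ψ r)) + 2 / (q + 1) * (|u r| ^ (q + 1) *
            (g' r * r ^ (n + 2) * ψ r + g r * r ^ (n + 2) * ψ' r
              + (M - 1) * g r * r ^ (n + 1) * ψ r))) ?_ ((i1.add i2).add i3)
  · rw [intervalIntegral.integral_add (i1.add i2) i3, intervalIntegral.integral_add i1 i2,
      intervalIntegral.integral_const_mul, intervalIntegral.integral_const_mul] at key
    have z1 : (0:ℝ) ^ p = 0 := Real.zero_rpow (by linarith)
    have z2 : (0:ℝ) ^ (q + 1) = 0 := Real.zero_rpow (by linarith)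
    simp only [hu1, hψ0, abs_zero, z1, z2] at key
    rw [hMp]
    have z3 : (0:ℝ) ^ (n + 2) = 0 := by simp
    simp only [one_pow] at key
    linear_combination -key
  · intro r hr
    have hr' := Ioo_subset_Icc_self hr
    have hnh := Icc_mem_nhds hr.1 hr.2
    have dg := (hg r hr').hasDerivAt hnh
    have dψ := (hψ r hr').hasDerivAt hnh
    have du := (hu r hr').hasDerivAt hnh
    have du' := (hu' r hr').hasDerivAt hnh
    have dP := (hasDerivAt_abs_rpow (u r) (show 1 < p by linarith)).comp r du
    have dQ := (hasDerivAt_abs_rpow (u r) (show 1 < q + 1 by linarith)).comp r du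
    have D := ((hasDerivAt_pow (n + 2) r).mul dψ).mul
      (((du'.pow 2).add (dP.const_mul (2 / p))).add ((dg.mul dQ).const_mul (2 / (q + 1))))
    refine D.congr_deriv ?_
    have ode := hode r hr
    rw [← hp2] at ode
    have e : q + 1 - 2 = q - 1 := by ring
    rw [e]
    simp only [Function.comp, Pi.mul_apply, Pi.add_apply, Pi.pow_apply]
    have hr0 : r ≠ 0 := hr.1.ne'
    have hu2 : u'' r = -(M - 1) / r * u' r - (|u r| ^ (p - 2) * u r + g r * |u r| ^ (q - 1) * u r) := by
      linear_combination -ode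
    rw [hu2]
    generalize |u r| ^ (p - 2) = a
    generalize |u r| ^ (q - 1) = b
    generalize |u r| ^ p = c
    generalize |u r| ^ (q + 1) = d
    have hp0 : p ≠ 0 := by linarith
    have hq0 : q + 1 ≠ 0 := by linarith
    clear_value p
    rw [hM3]
    push_cast
    field_simp
    ring
end

section
/- Let N ≥ 3 be an integer, q ≥ 1 a real number, g : [0,1] → ℝ continuous, and ψ : [0,1] → ℝ three times continuously differentiable with ψ(0) = 0. Let u : [0,1] → ℝ be twice continuously differentiable with u'(0) = 0 and u(1) = 0, satisfying −u''(r) − ((N−1)/r)·u'(r) = |u(r)|^(4/(N−2))·u(r) + g(r)·|u(r)|^(q−1)·u(r) for all r ∈ (0,1). Then (multiplying the equation by (r^(N−1)·ψ' − (N−1)·r^(N−2)·ψ)·u and integrating) one has: ∫₀¹ |u'(r)|²·( r^(N−1)·ψ'(r) − (N−1)·r^(N−2)·ψ(r) ) dr − (1/2)·∫₀¹ u(r)²·( r^(N−1)·ψ'''(r) + (N−1)(N−3)·r^(N−4)·(ψ(r) − r·ψ'(r)) ) dr = ∫₀¹ |u(r)|^(2N/(N−2))·( r^(N−1)·ψ'(r)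 − (N−1)·r^(N−2)·ψ(r) ) dr + ∫₀¹ g(r)·|u(r)|^(q+1)·( r^(N−1)·ψ'(r) − (N−1)·r^(N−2)·ψ(r) ) dr. -/
open MeasureTheory Filter Set

lemma aux_abs (x a b : ℝ) (ha : 0 ≤ a) (hb : b = a + 2) : |x| ^ b = |x| ^ a * x * x := by
  subst hb
  rw [Real.rpow_add' (abs_nonneg x) (by positivity)]
  have : |x| ^ (2:ℝ) = x * x := by
    rw [Real.rpow_two, sq_abs, sq]
  rw [this, mul_assoc]

theorem stmt_13 (N : ℕ) (hN : 3 ≤ N) (q : ℝ) (hq : 1 ≤ q)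
    (g ψ ψ' ψ'' ψ''' u u' u'' : ℝ → ℝ)
    (hg : ContinuousOn g (Icc (0:ℝ) 1))
    (hψ : ∀ r ∈ Icc (0:ℝ) 1, HasDerivWithinAt ψ (ψ' r) (Icc 0 1) r)
    (hψ' : ∀ r ∈ Icc (0:ℝ) 1, HasDerivWithinAt ψ' (ψ'' r) (Icc 0 1) r)
    (hψ'' : ∀ r ∈ Icc (0:ℝ) 1, HasDerivWithinAt ψ'' (ψ''' r) (Icc 0 1) r)
    (hψ''' : ContinuousOn ψ''' (Icc 0 1))
    (hψ0 : ψ 0 = 0)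
    (hu : ∀ r ∈ Icc (0:ℝ) 1, HasDerivWithinAt u (u' r) (Icc 0 1) r)
    (hu' : ∀ r ∈ Icc (0:ℝ) 1, HasDerivWithinAt u' (u'' r) (Icc 0 1) r)
    (hu'' : ContinuousOn u'' (Icc 0 1))
    (hu'0 : u' 0 = 0) (hu1 : u 1 = 0)
    (hode : ∀ r ∈ Ioo (0:ℝ) 1,
      -u'' r - ((N : ℝ) - 1) / r * u' r
        = |u r| ^ ((4:ℝ) / ((N : ℝ) - 2)) * u r + g r * |u r| ^ (q - 1) * u r) :
    (∫ r in (0:ℝ)..1, (u' r) ^ 2 *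
        (r ^ ((N : ℝ) - 1) * ψ' r - ((N : ℝ) - 1) * r ^ ((N : ℝ) - 2) * ψ r))
      - (1/2) * (∫ r in (0:ℝ)..1, (u r) ^ 2 *
          (r ^ ((N : ℝ) - 1) * ψ''' r
            + ((N : ℝ) - 1) * ((N : ℝ) - 3) * r ^ ((N : ℝ) - 4) * (ψ r - r * ψ' r)))
      = (∫ r in (0:ℝ)..1, |u r| ^ (2 * (N : ℝ) / ((N : ℝ) - 2)) *
            (r ^ ((N : ℝ) - 1) * ψ' r - ((N : ℝ) - 1) * r ^ ((N : ℝ) - 2) * ψ r))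
        + (∫ r in (0:ℝ)..1, g r * |u r| ^ (q + 1) *
            (r ^ ((N : ℝ) - 1) * ψ' r - ((N : ℝ) - 1) * r ^ ((N : ℝ) - 2) * ψ r)) := by
  obtain ⟨n, rfl⟩ : ∃ n, N = n + 3 := ⟨N - 3, by omega⟩
  have hn0 : (0:ℝ) ≤ n := Nat.cast_nonneg n
  have e1 : ∀ r : ℝ, r ^ (((n + 3 : ℕ) : ℝ) - 1) = r ^ (n + 2) := fun r => by
    rw [← Real.rpow_natCast]; congr 1; push_cast; ring
  have e2 : ∀ r : ℝ, r ^ (((n + 3 : ℕ) : ℝ) - 2) = r ^ (n + 1) := fun r => by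
    rw [← Real.rpow_natCast]; congr 1; push_cast; ring
  have e4 : ∀ r : ℝ, (((n + 3 : ℕ) : ℝ) - 1) * (((n + 3 : ℕ) : ℝ) - 3) * r ^ (((n + 3 : ℕ) : ℝ) - 4)
      = ((n:ℝ) + 2) * (n * r ^ (n - 1)) := fun r => by
    rcases n with _ | m
    · simp
    · rw [show (((m + 1 + 3 : ℕ) : ℝ) - 4) = (m : ℝ) by push_cast; ring, Real.rpow_natCast]
      push_cast
      simp
      ring
  have e5 : ∀ r, |u r| ^ (2 * ((n + 3 : ℕ) : ℝ) / (((n + 3 : ℕ) : ℝ) - 2))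
      = |u r| ^ ((4:ℝ) / (((n + 3 : ℕ) : ℝ) - 2)) * u r * u r := fun r => by
    have : (0:ℝ) < ((n + 3 : ℕ) : ℝ) - 2 := by push_cast; linarith
    apply aux_abs
    · positivity
    · field_simp; ring
  have e6 : ∀ r, |u r| ^ (q + 1) = |u r| ^ (q - 1) * u r * u r := fun r => by
    apply aux_abs
    · linarith
    · ring
  simp only [e1, e2, e4, e5, e6]
  have e7 : (((n + 3 : ℕ) : ℝ) - 1) = n + 2 := by push_cast; ring
  simp only [e7] at hode ⊢
  have hp : (0:ℝ) ≤ 4 / (((n + 3 : ℕ) : ℝ) - 2) := by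
    have : (0:ℝ) < ((n + 3 : ℕ) : ℝ) - 2 := by push_cast; linarith
    positivity
  generalize (4:ℝ) / (((n + 3 : ℕ) : ℝ) - 2) = p at *
  have cψ : ContinuousOn ψ (Icc 0 1) := fun r hr => (hψ r hr).continuousWithinAt
  have cψ' : ContinuousOn ψ' (Icc 0 1) := fun r hr => (hψ' r hr).continuousWithinAt
  have cψ'' : ContinuousOn ψ'' (Icc 0 1) := fun r hr => (hψ'' r hr).continuousWithinAt
  have cu : ContinuousOn u (Icc 0 1) := fun r hr => (hu r hr).continuousWithinAt
  have cu' : ContinuousOn u' (Icc 0 1) := fun r hr => (hu' r hr).continuousWithinAt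
  have cp : ContinuousOn (fun r => |u r| ^ p) (Icc 0 1) :=
    ContinuousOn.rpow_const cu.abs (fun _ _ => Or.inr hp)
  have cq : ContinuousOn (fun r => |u r| ^ (q - 1)) (Icc 0 1) :=
    ContinuousOn.rpow_const cu.abs (fun _ _ => Or.inr (by linarith))
  have ci : ∀ f : ℝ → ℝ, ContinuousOn f (Icc 0 1) → IntervalIntegrable f volume 0 1 :=
    fun f hf => hf.intervalIntegrable_of_Icc zero_le_one
  have i1 : IntervalIntegrable (fun r => (u' r) ^ 2 *
      (r ^ (n + 2) * ψ' r - ((n : ℝ) + 2) * r ^ (n + 1) * ψ r)) volume 0 1 :=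
    ci _ (by fun_prop)
  have i2 : IntervalIntegrable (fun r => (u r) ^ 2 *
      (r ^ (n + 2) * ψ''' r + ((n:ℝ) + 2) * (n * r ^ (n - 1)) * (ψ r - r * ψ' r))) volume 0 1 :=
    ci _ (by fun_prop)
  have i3 : IntervalIntegrable (fun r => |u r| ^ p * u r * u r *
      (r ^ (n + 2) * ψ' r - ((n : ℝ) + 2) * r ^ (n + 1) * ψ r)) volume 0 1 :=
    ci _ (by fun_prop)
  have i4 : IntervalIntegrable (fun r => g r * (|u r| ^ (q - 1) * u r * u r) *
      (r ^ (n + 2) * ψ' r - ((n : ℝ) + 2) * r ^ (n + 1) * ψ r)) volume 0 1 :=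
    ci _ (by fun_prop)
  rw [← intervalIntegral.integral_const_mul, ← intervalIntegral.integral_add i3 i4,
    ← intervalIntegral.integral_sub i1 (i2.const_mul _), ← sub_eq_zero,
    ← intervalIntegral.integral_sub (i1.sub (i2.const_mul _)) (i3.add i4)]
  rw [intervalIntegral.integral_eq_sub_of_hasDerivAt_of_le zero_le_one
    (f := fun r => u r * u' r * (r ^ (n + 2) * ψ' r - ((n : ℝ) + 2) * r ^ (n + 1) * ψ r)
      - 1 / 2 * (u r ^ 2 * (r ^ (n + 2) * ψ'' r - ((n : ℝ) + 2) * r ^ (n + 1) * ψ' r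
        + ((n : ℝ) + 2) * r ^ n * ψ r))) (by fun_prop) _
    ((i1.sub (i2.const_mul _)).sub (i3.add i4))]
  · simp [hu1, hψ0]
  · intro r hr
    have hr' : r ∈ Icc (0:ℝ) 1 := Ioo_subset_Icc_self hr
    have hnb : Icc (0:ℝ) 1 ∈ nhds r := Icc_mem_nhds hr.1 hr.2
    have d0 := (hψ r hr').hasDerivAt hnb
    have d1 := (hψ' r hr').hasDerivAt hnb
    have d2 := (hψ'' r hr').hasDerivAt hnb
    have v0 := (hu r hr').hasDerivAt hnb
    have v1 := (hu' r hr').hasDerivAt hnb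
    have p2 := hasDerivAt_pow (n + 2) r
    have p1 := hasDerivAt_pow (n + 1) r
    have p0 := hasDerivAt_pow n r
    have D := ((v0.mul v1).mul ((p2.mul d1).sub ((p1.const_mul ((n:ℝ) + 2)).mul d0))).sub
      (((v0.pow 2).mul (((p2.mul d2).sub ((p1.const_mul ((n:ℝ) + 2)).mul d1)).add
        ((p0.const_mul ((n:ℝ) + 2)).mul d0))).const_mul (1/2))
    refine D.congr_deriv ?_
    have ho := hode r hr
    have hr0 : r ≠ 0 := hr.1.ne'
    have ho2 : u'' r = -(((n:ℝ) + 2) / r * u' r) - (|u r| ^ p * u r + g r * |u r| ^ (q - 1) * u r) := by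
      linarith
    have hpow : (n:ℝ) * r ^ n = n * r ^ (n - 1) * r := by
      rcases n with _ | m
      · simp
      · simp [pow_succ, mul_assoc]
    simp only [Pi.mul_apply, Pi.sub_apply, Pi.add_apply, Pi.pow_apply, Nat.add_sub_cancel, show n + 2 - 1 = n + 1 from rfl]
    rw [ho2]
    generalize |u r| ^ p = A
    generalize |u r| ^ (q - 1) = B
    have h1 : ((n:ℝ) + 2) / r * (r ^ (n + 2)) = (n + 2) * r ^ (n + 1) := by
      field_simp
      ring
    have h2 : ((n:ℝ) + 2) / r * (r ^ (n + 1)) = (n + 2) * r ^ n := by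
      field_simp
      ring
    have h3 : r ^ (n + 1) = r ^ n * r := pow_succ r n
    generalize ((n:ℝ) + 2) / r = K at *
    push_cast
    generalize r ^ (n - 1) = P at *
    generalize r ^ (n + 2) = P2 at *
    generalize r ^ (n + 1) = P1 at *
    generalize r ^ n = P0 at *
    linear_combination (-(u r * u' r * ψ' r)) * h1 + (n + 2) * u r * u' r * ψ r * h2 + 1/2 * u r ^ 2 * (n + 2) * ψ' r * hpow
end

section
/- Let N ≥ 3 be an integer, γ > 0, and set p = max{1, (2γ+6−N)/(N−2)}. Let f : ℝ → ℝ be continuous with f(t) ≥ 0 for all t ≥ 0, and suppose f(t)/t^p → ∞ as t → ∞. Define F(t) = ∫₀ᵗ f(s) ds. Then lim_{ε→0⁺} ε^(γ+2) · ∫₀^(1/ε) F( (ε^(−1)/(1+r²))^((N−2)/2) ) · r^(γ+N−1) dr = ∞, i.e. the quantity tends to infinity as ε tends to 0 from above. -/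
open MeasureTheory Filter Set

lemma aux_lower (g : ℝ → ℝ) (hg : Continuous g) (a' a b b' c : ℝ) (h1 : a' ≤ a) (h2 : a ≤ b)
    (h3 : b ≤ b') (hn : ∀ x, a' ≤ x → x ≤ b' → 0 ≤ g x) (hc : ∀ x, a ≤ x → x ≤ b → c ≤ g x) :
    c * (b - a) ≤ ∫ x in a'..b', g x := by
  have e1 : (∫ x in a'..a, g x) + (∫ x in a..b, g x) + (∫ x in b..b', g x) = ∫ x in a'..b', g x := by
    rw [intervalIntegral.integral_add_adjacent_intervals (hg.intervalIntegrable _ _)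
      (hg.intervalIntegrable _ _), intervalIntegral.integral_add_adjacent_intervals
      (hg.intervalIntegrable _ _) (hg.intervalIntegrable _ _)]
  have e2 : 0 ≤ ∫ x in a'..a, g x := intervalIntegral.integral_nonneg h1
    fun x hx => hn x hx.1 (by linarith [hx.2])
  have e3 : 0 ≤ ∫ x in b..b', g x := intervalIntegral.integral_nonneg h3
    fun x hx => hn x (by linarith [hx.1]) hx.2
  have e4 : ∫ x in a..b, c ≤ ∫ x in a..b, g x :=
    intervalIntegral.integral_mono_on h2 (by simp) (hg.intervalIntegrable _ _)
      fun x hx => hc x hx.1 hx.2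
  rw [intervalIntegral.integral_const, smul_eq_mul] at e4
  linarith

lemma aux_F (f : ℝ → ℝ) (hf_cont : Continuous f) (hf_nonneg : ∀ t : ℝ, 0 ≤ t → 0 ≤ f t)
    (p : ℝ) (hp : 0 ≤ p) (hf : Tendsto (fun t => f t / t ^ p) atTop atTop) (C : ℝ) (hC : 0 ≤ C) :
    ∀ᶠ T in atTop, C * T ^ (p + 1) ≤ ∫ s in (0:ℝ)..T, f s := by
  obtain ⟨A, hA⟩ := (hf.eventually_ge_atTop (C * 2 ^ (p + 1))).exists_forall_of_atTop
  filter_upwards [eventually_ge_atTop (2 * A), eventually_gt_atTop 0] with T hT hT0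
  have key := aux_lower f hf_cont 0 (T / 2) T T (C * 2 ^ (p + 1) * (T / 2) ^ p) (by linarith)
    (by linarith) le_rfl (fun x hx _ => hf_nonneg x hx) (fun x hx _ => by
      have hx0 : 0 < x := by linarith
      have := hA x (by linarith)
      rw [le_div_iff₀ (by positivity)] at this
      refine le_trans ?_ this
      gcongr)
  refine le_trans (le_of_eq ?_) key
  have : (2:ℝ) ^ (p + 1) * (T / 2) ^ (p + 1) = T ^ (p + 1) := by
    rw [← Real.mul_rpow (by norm_num) (by linarith)]
    congr 1; ring
  rw [← this, Real.rpow_add_one (x := T / 2) (by positivity)]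
  ring

theorem stmt_15 (N : ℕ) (hN : 3 ≤ N) (γ : ℝ) (hγ : 0 < γ)
    (f : ℝ → ℝ) (hf_cont : Continuous f)
    (hf_nonneg : ∀ t : ℝ, 0 ≤ t → 0 ≤ f t)
    (hf : Tendsto (fun t => f t / t ^ (max 1 ((2 * γ + 6 - (N : ℝ)) / ((N : ℝ) - 2))))
      atTop atTop) :
    Tendsto (fun ε : ℝ => ε ^ (γ + 2) *
        ∫ r in (0:ℝ)..(1/ε),
          (∫ s in (0:ℝ)..((ε⁻¹ / (1 + r ^ 2)) ^ (((N : ℝ) - 2) / 2)), f s)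
            * r ^ (γ + (N : ℝ) - 1))
      (nhdsWithin 0 (Ioi 0)) atTop := by
  have hN' : (3:ℝ) ≤ N := by exact_mod_cast hN
  set p := max 1 ((2 * γ + 6 - (N : ℝ)) / ((N : ℝ) - 2)) with hpdef
  have hp1 : 1 ≤ p := le_max_left _ _
  have hp2 : (2 * γ + 6 - (N : ℝ)) / ((N : ℝ) - 2) ≤ p := le_max_right _ _
  set a := ((N : ℝ) - 2) / 2 with ha
  have ha0 : 0 < a := by rw [ha]; linarith
  have hq : γ + 2 ≤ a * (p + 1) := by
    rw [div_le_iff₀ (by linarith)] at hp2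
    rw [ha]; nlinarith
  clear_value p
  set k := γ + (N : ℝ) - 1 with hk
  have hk0 : 0 < k := by rw [hk]; linarith
  clear_value k a
  rw [tendsto_atTop]
  intro B
  set K : ℝ := (1/2 : ℝ) ^ (γ + 2) * (1/2 : ℝ) ^ k * (1/2) with hK
  have hK0 : 0 < K := by positivity
  have hF := aux_F f hf_cont hf_nonneg p (by linarith) hf (|B| / K) (by positivity)
  have hlim : Tendsto (fun ε : ℝ => (ε⁻¹ / 2) ^ a) (nhdsWithin 0 (Ioi 0)) atTop :=
    (tendsto_rpow_atTop ha0).comp (tendsto_inv_nhdsGT_zero.atTop_div_const (by norm_num))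
  have hsmall : ∀ᶠ ε : ℝ in nhdsWithin 0 (Ioi 0), ε ∈ Ioo (0:ℝ) (1/2) :=
    Ioo_mem_nhdsGT (by norm_num)
  filter_upwards [hlim.eventually hF, hsmall] with ε hε hε'
  obtain ⟨h0, h1⟩ := hε'
  have hinv : 2 ≤ ε⁻¹ := by
    rw [le_inv_comm₀ (by norm_num) h0]; linarith
  have hx1 : 1 ≤ ε⁻¹ / 2 := by linarith
  set x := ε⁻¹ / 2 with hx
  set F0 := ∫ s in (0:ℝ)..(x ^ a), f s with hF0
  have hF0n : 0 ≤ F0 := intervalIntegral.integral_nonneg (by positivity)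
    fun s hs => hf_nonneg s hs.1
  have hii : ∀ u v : ℝ, IntervalIntegrable f volume u v := fun u v =>
    hf_cont.intervalIntegrable u v
  have hcont : Continuous fun r : ℝ =>
      (∫ s in (0:ℝ)..((ε⁻¹ / (1 + r ^ 2)) ^ a), f s) * r ^ k := by
    have c1 : Continuous fun r : ℝ => (ε⁻¹ / (1 + r ^ 2)) ^ a := by
      refine Continuous.rpow_const ?_ (fun _ => Or.inr ha0.le)
      exact continuous_const.div (by fun_prop) (fun r => by positivity)
    exact ((intervalIntegral.continuous_primitive hii 0).comp c1).mul
      (Real.continuous_rpow_const hk0.le)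
  have key := aux_lower _ hcont 0 (1/2) 1 (1/ε) (F0 * (1/2 : ℝ) ^ k) (by norm_num) (by norm_num)
    (by rw [one_div]; linarith)
    (fun r hr _ => mul_nonneg (intervalIntegral.integral_nonneg (by positivity)
      fun s hs => hf_nonneg s hs.1) (by positivity))
    (fun r hr hr1 => by
      have hle : x ^ a ≤ (ε⁻¹ / (1 + r ^ 2)) ^ a := by
        rw [hx]
        gcongr
        nlinarith
      have hxa : 0 ≤ x ^ a := by positivity
      have m : F0 ≤ ∫ s in (0:ℝ)..((ε⁻¹ / (1 + r ^ 2)) ^ a), f s := by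
        rw [← intervalIntegral.integral_add_adjacent_intervals (hii 0 (x ^ a)) (hii (x ^ a) ((ε⁻¹ / (1 + r ^ 2)) ^ a))]
        have := intervalIntegral.integral_nonneg (μ := volume) hle
          fun s hs => hf_nonneg s (hxa.trans hs.1)
        linarith
      have m0 := hF0n.trans m
      gcongr)
  have hpow : x ^ (γ + 2) ≤ (x ^ a) ^ (p + 1) := by
    rw [← Real.rpow_mul (by linarith)]
    exact Real.rpow_le_rpow_of_exponent_le hx1 hq
  have hex : ε ^ (γ + 2) * x ^ (γ + 2) = (1/2 : ℝ) ^ (γ + 2) := by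
    rw [← Real.mul_rpow h0.le (by linarith), hx]
    congr 1; field_simp
  have hFB : |B| / K * x ^ (γ + 2) ≤ F0 := le_trans (by gcongr) hε
  calc B ≤ |B| := le_abs_self B
    _ = |B| / K * K := by field_simp
    _ = ε ^ (γ + 2) * ((|B| / K * x ^ (γ + 2)) * (1/2 : ℝ) ^ k * (1 - 1/2)) := by
        have : K = ε ^ (γ + 2) * x ^ (γ + 2) * (1/2 : ℝ) ^ k * (1/2) := by rw [hex]
        rw [show |B| / K * K = |B| / K * (ε ^ (γ + 2) * x ^ (γ + 2) * (1/2 : ℝ) ^ k * (1/2)) by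
          rw [← this]]
        ring
    _ ≤ ε ^ (γ + 2) * (F0 * (1/2 : ℝ) ^ k * (1 - 1/2)) := by
        have : (0:ℝ) ≤ 1 - 1/2 := by norm_num
        gcongr
    _ ≤ _ := by gcongr
end

section
/- Let N ≥ 3 be an integer, γ > 0, and D ∈ (0,1). Let f : ℝ → ℝ be continuous with f(t) ≥ 0 for all t ≥ 0, and suppose f(t)/t → 0 as t → 0⁺. Define F(t) = ∫₀ᵗ f(s) ds. Then lim_{ε→0⁺} ε^(γ+2) · ∫_(D/ε)^(1/ε) F( (ε^(−1)/(1+r²))^((N−2)/2) ) · r^(γ+N−1) dr = 0. -/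
open MeasureTheory Filter Set

theorem stmt_16 (N : ℕ) (hN : 3 ≤ N) (γ D : ℝ) (hγ : 0 < γ) (hD : D ∈ Ioo (0:ℝ) 1)
    (f : ℝ → ℝ) (hf_cont : Continuous f)
    (hf_nonneg : ∀ t : ℝ, 0 ≤ t → 0 ≤ f t)
    (hf : Tendsto (fun t => f t / t) (nhdsWithin 0 (Ioi 0)) (nhds 0)) :
    Tendsto (fun ε : ℝ => ε ^ (γ + 2) *
        ∫ r in (D/ε)..(1/ε),
          (∫ s in (0:ℝ)..((ε⁻¹ / (1 + r ^ 2)) ^ (((N : ℝ) - 2) / 2)), f s)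
            * r ^ (γ + (N : ℝ) - 1))
      (nhdsWithin 0 (Ioi 0)) (nhds 0) := by
  obtain ⟨hD0, hD1⟩ := hD
  have hN' : (3:ℝ) ≤ N := by exact_mod_cast hN
  set p : ℝ := ((N : ℝ) - 2) / 2 with hp
  have hp0 : 0 < p := by rw [hp]; linarith
  set C : ℝ := ((D ^ 2)⁻¹) ^ p with hC
  have hC0 : 0 < C := by rw [hC]; positivity
  rw [Metric.tendsto_nhds]
  intro η' hη'
  set η : ℝ := η' / (2 * C ^ 2) with hη
  have hη0 : 0 < η := by rw [hη]; positivity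
  have h1 := (Metric.tendsto_nhds.1 hf) η hη0
  obtain ⟨δ, hδ0, hδ⟩ := (mem_nhdsGT_iff_exists_Ioo_subset).1 h1
  have hδ0 : 0 < δ := hδ0
  have hT : Tendsto (fun ε : ℝ => C * ε ^ p) (nhdsWithin 0 (Ioi 0)) (nhds 0) := by
    have : Tendsto (fun ε : ℝ => C * ε ^ p) (nhds 0) (nhds (C * 0 ^ p)) :=
      (((Real.continuous_rpow_const hp0.le).tendsto 0).const_mul C)
    rw [Real.zero_rpow hp0.ne', mul_zero] at this
    exact this.mono_left nhdsWithin_le_nhds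
  filter_upwards [hT.eventually (gt_mem_nhds hδ0), self_mem_nhdsWithin] with ε hεT hε
  have hε : 0 < ε := hε
  have hle : D / ε ≤ 1 / ε := by gcongr
  have key : ∀ r ∈ Set.uIoc (D/ε) (1/ε),
      ‖(∫ s in (0:ℝ)..((ε⁻¹ / (1 + r ^ 2)) ^ p), f s) * r ^ (γ + (N : ℝ) - 1)‖
        ≤ (η * (C * ε ^ p) * (C * ε ^ p)) * (1/ε) ^ (γ + (N : ℝ) - 1) := by
    intro r hr
    rw [Set.uIoc_of_le hle] at hr
    have hr0 : 0 < r := lt_trans (by positivity) hr.1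
    have hb : ε⁻¹ / (1 + r ^ 2) ≤ (D ^ 2)⁻¹ * ε := by
      have h2 : (D/ε)^2 ≤ 1 + r^2 := by
        have : (D/ε)^2 ≤ r^2 := by gcongr; exact hr.1.le
        linarith
      calc ε⁻¹ / (1 + r ^ 2) ≤ ε⁻¹ / (D/ε)^2 := by gcongr
        _ = (D ^ 2)⁻¹ * ε := by field_simp
    have hTb : (ε⁻¹ / (1 + r ^ 2)) ^ p ≤ C * ε ^ p := by
      rw [hC, ← Real.mul_rpow (by positivity) hε.le]
      exact Real.rpow_le_rpow (by positivity) hb hp0.le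
    set T := (ε⁻¹ / (1 + r ^ 2)) ^ p with hTdef
    have hT0 : 0 < T := by rw [hTdef]; positivity
    have hF : ‖∫ s in (0:ℝ)..T, f s‖ ≤ η * T * |T - 0| := by
      apply intervalIntegral.norm_integral_le_of_norm_le_const
      intro s hs
      rw [Set.uIoc_of_le hT0.le] at hs
      have h3 := hδ (show s ∈ Ioo 0 δ from ⟨hs.1, by linarith [hs.2]⟩)
      simp only [mem_setOf_eq, dist_zero_right, norm_div] at h3
      rw [Real.norm_of_nonneg hs.1.le, div_lt_iff₀ hs.1] at h3
      exact h3.le.trans (by gcongr; exact hs.2)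
    rw [sub_zero, abs_of_pos hT0] at hF
    rw [norm_mul, Real.norm_of_nonneg (Real.rpow_nonneg hr0.le _)]
    have hrr : r ^ (γ + (N : ℝ) - 1) ≤ (1/ε) ^ (γ + (N : ℝ) - 1) :=
      Real.rpow_le_rpow hr0.le hr.2 (by linarith)
    have hF2 : η * T * T ≤ η * (C * ε ^ p) * (C * ε ^ p) := by gcongr
    exact mul_le_mul (hF.trans hF2) hrr (Real.rpow_nonneg hr0.le _) (by positivity)
  have hI := intervalIntegral.norm_integral_le_of_norm_le_const key
  have hlen : |1/ε - D/ε| ≤ 1/ε := by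
    rw [abs_of_nonneg (by linarith)]
    have : 0 < D/ε := by positivity
    linarith
  rw [dist_zero_right, norm_mul, Real.norm_of_nonneg (Real.rpow_nonneg hε.le _)]
  have hfin : ε ^ (γ + 2) * ((η * (C * ε ^ p) * (C * ε ^ p)) * (1/ε) ^ (γ + (N : ℝ) - 1) * (1/ε))
      = η' / 2 := by
    have e1 : (1/ε) ^ (γ + (N : ℝ) - 1) = ε ^ (-(γ + (N : ℝ) - 1)) := by
      rw [one_div, Real.inv_rpow hε.le, Real.rpow_neg hε.le]
    have e2 : 1/ε = ε ^ (-1:ℝ) := by rw [Real.rpow_neg_one, one_div]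
    have e3 : ε ^ (γ + 2) * ε ^ p * ε ^ p * ε ^ (-(γ + (N : ℝ) - 1)) * ε ^ (-1:ℝ) = 1 := by
      rw [← Real.rpow_add hε, ← Real.rpow_add hε, ← Real.rpow_add hε, ← Real.rpow_add hε]
      rw [show γ + 2 + p + p + -(γ + (N:ℝ) - 1) + -1 = 0 by rw [hp]; ring, Real.rpow_zero]
    rw [e1, e2]
    calc _ = η * C^2 * (ε ^ (γ + 2) * ε ^ p * ε ^ p * ε ^ (-(γ + (N : ℝ) - 1)) * ε ^ (-1:ℝ)) := by ring
      _ = η' / 2 := by rw [e3, hη]; field_simp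
  calc _ ≤ ε ^ (γ + 2) * ((η * (C * ε ^ p) * (C * ε ^ p)) * (1/ε) ^ (γ + (N : ℝ) - 1) * (1/ε)) := by
        gcongr
        exact hI.trans (by gcongr)
    _ = η' / 2 := hfin
    _ < η' := by linarith
end

section
/- Let N ≥ 3 be an integer, γ ≥ 0, η > 0, and let q > 0 be a real number such that (N−2)(q+1) > γ + N and a := γ + N − (N−2)(q+1)/2 > 0. Then the integral ∫_{ℝ^N} |y|^γ·(1+|y|²)^(−(N−2)(q+1)/2) dy is finite, and lim_{ε→0⁺} ε^(−a) · ∫_{|x|<η} |x|^γ · ( ε/(ε²+|x|²) )^((N−2)(q+1)/2) dx = ∫_{ℝ^N} |y|^γ·(1+|y|²)^(−(N−2)(q+1)/2) dy. -/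
open MeasureTheory Filter Set Metric

theorem stmt_17 (N : ℕ) (hN : 3 ≤ N) (γ η q : ℝ) (hγ : 0 ≤ γ) (hη : 0 < η) (hq : 0 < q)
    (h1 : γ + (N : ℝ) < ((N : ℝ) - 2) * (q + 1))
    (h2 : 0 < γ + (N : ℝ) - ((N : ℝ) - 2) * (q + 1) / 2) :
    Integrable (fun y : EuclideanSpace ℝ (Fin N) =>
      ‖y‖ ^ γ * (1 + ‖y‖ ^ 2) ^ (-(((N : ℝ) - 2) * (q + 1) / 2))) ∧
    Tendsto (fun ε : ℝ => ε ^ (-(γ + (N : ℝ) - ((N : ℝ) - 2) * (q + 1) / 2)) *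
        ∫ x in ball (0 : EuclideanSpace ℝ (Fin N)) η,
          ‖x‖ ^ γ * (ε / (ε ^ 2 + ‖x‖ ^ 2)) ^ (((N : ℝ) - 2) * (q + 1) / 2))
      (nhdsWithin 0 (Ioi 0))
      (nhds (∫ y : EuclideanSpace ℝ (Fin N),
        ‖y‖ ^ γ * (1 + ‖y‖ ^ 2) ^ (-(((N : ℝ) - 2) * (q + 1) / 2)))) := by
  generalize hp : ((N : ℝ) - 2) * (q + 1) / 2 = p at *
  have hp' : γ + N < 2 * p := by linarith
  have hint : Integrable (fun y : EuclideanSpace ℝ (Fin N) =>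
      ‖y‖ ^ γ * (1 + ‖y‖ ^ 2) ^ (-p)) := by
    have hr : (Module.finrank ℝ (EuclideanSpace ℝ (Fin N)) : ℝ) < 2 * p - γ := by
      rw [finrank_euclideanSpace_fin]; linarith
    refine (integrable_rpow_neg_one_add_norm_sq (μ := volume) hr).mono'
      (Measurable.aestronglyMeasurable (by fun_prop)) (Eventually.of_forall fun y => ?_)
    have hpos : (0 : ℝ) < 1 + ‖y‖ ^ 2 := by positivity
    rw [Real.norm_of_nonneg (by positivity)]
    have e : (1 + ‖y‖ ^ 2) ^ (-(2 * p - γ) / 2) =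
        (1 + ‖y‖ ^ 2) ^ (γ / 2) * (1 + ‖y‖ ^ 2) ^ (-p) := by
      rw [← Real.rpow_add hpos]; congr 1; ring
    have e2 : ‖y‖ ^ γ = (‖y‖ ^ 2) ^ (γ / 2) := by
      rw [← Real.rpow_natCast ‖y‖ 2, ← Real.rpow_mul (norm_nonneg y)]; congr 1; push_cast; ring
    rw [e, e2]
    gcongr
    linarith
  refine ⟨hint, ?_⟩
  have hlim : Tendsto (fun ε : ℝ => ε⁻¹ * η) (nhdsWithin 0 (Ioi 0)) atTop :=
    tendsto_inv_nhdsGT_zero.atTop_mul_const hη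
  have hcov := aecover_ball (μ := (volume : Measure (EuclideanSpace ℝ (Fin N))))
    (x := 0) hlim
  refine (hcov.integral_tendsto_of_countably_generated hint).congr' ?_
  filter_upwards [self_mem_nhdsWithin] with ε hε
  have hε : 0 < ε := hε
  have hF : ∀ x : EuclideanSpace ℝ (Fin N),
      ‖x‖ ^ γ * (ε / (ε ^ 2 + ‖x‖ ^ 2)) ^ p =
      ε ^ (γ - p) * (‖ε⁻¹ • x‖ ^ γ * (1 + ‖ε⁻¹ • x‖ ^ 2) ^ (-p)) := by
    intro x
    obtain ⟨y, rfl⟩ : ∃ y, x = ε • y := ⟨ε⁻¹ • x, by rw [smul_inv_smul₀ hε.ne']⟩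
    rw [inv_smul_smul₀ hε.ne', norm_smul, Real.norm_of_nonneg hε.le]
    have hpos : (0 : ℝ) < 1 + ‖y‖ ^ 2 := by positivity
    have e : ε / (ε ^ 2 + (ε * ‖y‖) ^ 2) = (ε * (1 + ‖y‖ ^ 2))⁻¹ := by
      field_simp
    rw [e, Real.inv_rpow (by positivity), Real.mul_rpow hε.le hpos.le,
      Real.mul_rpow hε.le (norm_nonneg y), Real.rpow_sub hε, Real.rpow_neg hpos.le]
    field_simp
  simp_rw [hF]
  rw [integral_const_mul, Measure.setIntegral_comp_smul_of_pos volume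
    (fun y : EuclideanSpace ℝ (Fin N) => ‖y‖ ^ γ * (1 + ‖y‖ ^ 2) ^ (-p)) _ (inv_pos.2 hε),
    _root_.smul_ball (inv_pos.2 hε).ne', smul_zero, Real.norm_of_nonneg (inv_pos.2 hε).le,
    finrank_euclideanSpace_fin, smul_eq_mul, inv_pow, inv_inv, ← mul_assoc, ← mul_assoc,
    ← Real.rpow_natCast ε N, ← Real.rpow_add hε, ← Real.rpow_add hε]
  have : -(γ + N - p) + (γ - p) + N = 0 := by ring
  rw [this, Real.rpow_zero, one_mul]
end

section
/- Let N ≥ 3 be an integer and β ≥ N−2 a real number. Define λ_* = 2(N−1)/(N−2) if β = N−2, and λ_* = (2(N−1)/(N−2)) · ((2N−2+β)/(β−N+2))^((β−N+2)/(N−2)) if β > N−2. Then for every λ ∈ [0, λ_*] and every r ∈ (0,1], one has 2(N−1) + λ·(2N−2+β)·r^β − λ·β·r^(β−N+2) ≥ 0. -/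
open Set

theorem stmt_18 (N : ℕ) (hN : 3 ≤ N) (β : ℝ) (hβ : (N : ℝ) - 2 ≤ β)
    (lamstar : ℝ)
    (hls_eq : β = (N : ℝ) - 2 → lamstar = 2 * ((N : ℝ) - 1) / ((N : ℝ) - 2))
    (hls_gt : (N : ℝ) - 2 < β → lamstar = 2 * ((N : ℝ) - 1) / ((N : ℝ) - 2) *
      ((2 * (N : ℝ) - 2 + β) / (β - (N : ℝ) + 2)) ^ ((β - (N : ℝ) + 2) / ((N : ℝ) - 2)))
    (lam : ℝ) (hlam : lam ∈ Icc 0 lamstar) (r : ℝ) (hr : r ∈ Ioc (0:ℝ) 1) :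
    0 ≤ 2 * ((N : ℝ) - 1) + lam * (2 * (N : ℝ) - 2 + β) * r ^ β
        - lam * β * r ^ (β - (N : ℝ) + 2) := by
  obtain ⟨hl0, hl1⟩ := hlam
  obtain ⟨hr0, hr1⟩ := hr
  have hN' : (3:ℝ) ≤ N := by exact_mod_cast hN
  obtain ⟨m, hm⟩ : ∃ m : ℝ, m = (N:ℝ) - 2 := ⟨_, rfl⟩
  have hm0 : 0 < m := by linarith
  obtain ⟨C, hC⟩ : ∃ C : ℝ, C = 2 * (N:ℝ) - 2 + β := ⟨_, rfl⟩
  have hC0 : 0 < C := by linarith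
  obtain ⟨a, ha⟩ : ∃ a : ℝ, a = β - (N:ℝ) + 2 := ⟨_, rfl⟩
  obtain ⟨K, hK⟩ : ∃ K : ℝ, K = 2 * ((N:ℝ) - 1) := ⟨_, rfl⟩
  have hK0 : 0 < K := by linarith
  have hβ' : β = a + m := by linarith
  rw [← hm, ← hK] at hls_eq
  rw [← hm, ← hK, ← hC, ← ha] at hls_gt
  rw [← hC, ← ha, ← hK]
  rw [← hm] at hβ
  rcases hβ.eq_or_lt with h | h
  · have ha0 : a = 0 := by linarith
    rw [hls_eq h.symm, le_div_iff₀ hm0] at hl1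
    rw [ha0, Real.rpow_zero, ← h]
    have : 0 ≤ lam * C * r ^ m := by positivity
    linarith
  · have ha0 : 0 < a := by linarith
    have hl := hls_gt h
    obtain ⟨Q, hQ⟩ : ∃ Q : ℝ, Q = (C / a) ^ (a / m) := ⟨_, rfl⟩
    have hQ0 : 0 < Q := by rw [hQ]; positivity
    rw [← hQ] at hl
    have hM0 : 0 < r ^ m := by positivity
    have hA0 : 0 < r ^ a := by positivity
    have hrβ : r ^ β = r ^ a * r ^ m := by rw [hβ', Real.rpow_add hr0]
    have hrm : (r ^ m) ^ (a / m) = r ^ a := by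
      rw [← Real.rpow_mul hr0.le]; congr 1; field_simp
    obtain ⟨v, hv⟩ : ∃ v : ℝ, v = C / a * r ^ m := ⟨_, rfl⟩
    have hv0 : 0 < v := by rw [hv]; positivity
    have hvs : v ^ (a / m) = Q * r ^ a := by
      rw [hv, Real.mul_rpow (by positivity) hM0.le, hrm, hQ]
    have hu0 : 0 < v⁻¹ := by positivity
    have hb := one_add_mul_self_le_rpow_one_add (s := v⁻¹ - 1) (by linarith)
      (p := a / m + 1) (by have : 0 < a / m := by positivity
                           linarith)
    rw [add_sub_cancel, Real.rpow_add hu0, Real.rpow_one, Real.inv_rpow hv0.le, hvs] at hb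
    obtain ⟨W, hW⟩ : ∃ W : ℝ, W = Q * r ^ a := ⟨_, rfl⟩
    have hW0 : 0 < W := by rw [hW]; positivity
    rw [← hW] at hb
    have h1 := mul_le_mul_of_nonneg_left hb (by positivity : 0 ≤ W * v * m)
    have e1 : W * v * m * (W⁻¹ * v⁻¹) = m := by field_simp
    have e2 : W * v * m * (1 + (a / m + 1) * (v⁻¹ - 1)) = W * (a + m - a * v) := by
      field_simp; ring
    have e3 : a * v = C * r ^ m := by rw [hv]; field_simp
    rw [e1, e2, e3, ← hβ', hW] at h1
    rw [hrβ]
    obtain ⟨X, hX⟩ : ∃ X : ℝ, X = r ^ a * (β - C * r ^ m) := ⟨_, rfl⟩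
    have h2 : Q * X ≤ m := by rw [hX]; linarith
    have h3 : lam * X ≤ K := by
      rcases le_total X 0 with hx | hx
      · nlinarith [mul_nonneg hl0 (neg_nonneg.2 hx)]
      · calc lam * X ≤ (K / m * Q) * X := by rw [← hl]; gcongr
          _ = K / m * (Q * X) := by ring
          _ ≤ K / m * m := by gcongr
          _ = K := by field_simp
    rw [hX] at h3
    linarith
end
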